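/- arXiv:2202.09495 — 4 statements merged into one kernel-verified Lean document; each statement's English description precedes it below -/
import Mathlib

section
/- Polynomial-length water-move solutions: let S₀ be an initial configuration with exactly n full bins and let ℓ₀ = min(h, n). If there exists a sorted configuration T with S₀ ⇒* T, then there exists a sequence of at most 2·(h − 1)·n·ℓ₀ water-moves from S₀ to some sorted configuration. -/
open scoped Classical

noncomputable section

/-- A configuration: each bin holds a list of colors (bottom to top) of length at most `h`. -/
def Config {B C : Type*} (h : ℕ) (S : B → List C) : Prop := ∀ b, (S b).length ≤ h

/-- An initial configuration: every bin is full (length `h`) or empty. -/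
def InitConfig {B C : Type*} (h : ℕ) (S : B → List C) : Prop :=
  ∀ b, (S b).length = h ∨ (S b).length = 0

/-- A sorted (goal) configuration: every bin is empty or monochromatically full. -/
def SortedConfig {B C : Type*} (h : ℕ) (S : B → List C) : Prop :=
  ∀ b, S b = [] ∨ ∃ c, S b = List.replicate h c

/-- A ball-move from `S` to `S'`. -/
def BallMove {B C : Type*} (h : ℕ) (S S' : B → List C) : Prop :=
  ∃ b₁ b₂ c, b₁ ≠ b₂ ∧
    S b₁ = S' b₁ ++ [c] ∧
    (S b₂ = [] ∨ (S b₂).getLast? = some c) ∧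
    S' b₂ = S b₂ ++ [c] ∧ (S' b₂).length ≤ h ∧
    ∀ b, b ≠ b₁ → b ≠ b₂ → S' b = S b

/-- A water-move from `S` to `S'`. -/
def WaterMove {B C : Type*} (h : ℕ) (S S' : B → List C) : Prop :=
  ∃ b₁ b₂ c m, 1 ≤ m ∧ b₁ ≠ b₂ ∧
    S b₁ = S' b₁ ++ List.replicate m c ∧
    (S b₂ = [] ∨ (S b₂).getLast? = some c) ∧
    S' b₂ = S b₂ ++ List.replicate m c ∧ (S' b₂).length ≤ h ∧
    ((S' b₁).getLast? ≠ some c ∨ (S' b₂).length = h) ∧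
    ∀ b, b ≠ b₁ → b ≠ b₂ → S' b = S b

/-- `i` is a border of the list `α` (1-indexed): `i = 0`, or `1 ≤ i < |α|` and `α[i] ≠ α[i+1]`. -/
def IsBorder {C : Type*} (α : List C) (i : ℕ) : Prop :=
  i = 0 ∨ (1 ≤ i ∧ i < α.length ∧ α[i-1]? ≠ α[i]?)

/-- The set `D(α)` of borders of `α`. -/
def borders {C : Type*} (α : List C) : Finset ℕ :=
  (Finset.range (α.length + 1)).filter (IsBorder α)

/-- The top border `max D(α)` of a list. -/
def topBorder {C : Type*} (α : List C) : ℕ := (borders α).sup id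

/-- The top-border table `τ_S` of a configuration. -/
def tbt {B C : Type*} (S : B → List C) : B → ℕ := fun b => topBorder (S b)

/-- `F_c(τ)`: the number of units of color `c` above the borders of `τ` in `S₀`. -/
def Fcnt {B C : Type*} [Fintype B] (h : ℕ) (S₀ : B → List C) (τ : B → ℕ) (c : C) : ℕ :=
  ∑ b, ((Finset.Icc (τ b + 1) h).filter (fun i => (S₀ b)[i-1]? = some c)).card

/-- `B_ε(τ)`: the bins whose top border is `0`. -/
def Beps {B : Type*} [Fintype B] (τ : B → ℕ) : Finset B :=
  Finset.univ.filter (fun b => τ b = 0)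

/-- `B_c(τ)`: the non-monochrome bins whose top color is `c` (determined from `S₀`). -/
def Bcol {B C : Type*} [Fintype B] (S₀ : B → List C) (τ : B → ℕ) (c : C) : Finset B :=
  Finset.univ.filter (fun b => τ b ≠ 0 ∧ (S₀ b)[τ b]? = some c)

/-- `G_c(τ) = Σ_{b ∈ B_c(τ)} (h − τ(b))`. -/
def Gcnt {B C : Type*} [Fintype B] (h : ℕ) (S₀ : B → List C) (τ : B → ℕ) (c : C) : ℕ :=
  ∑ b ∈ Bcol S₀ τ c, (h - τ b)

/-- `M_c(τ) = max(0, ⌈(F_c(τ) − G_c(τ))/h⌉)`. -/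
def Mcnt {B C : Type*} [Fintype B] (h : ℕ) (S₀ : B → List C) (τ : B → ℕ) (c : C) : ℕ :=
  (⌈((Fcnt h S₀ τ c : ℚ) - (Gcnt h S₀ τ c : ℚ)) / (h : ℚ)⌉).toNat

/-- `M_c^b(τ) = max(0, ⌈(F_c(τ) − G_c(τ) + (h − τ(b)))/h⌉)`. -/
def McntB {B C : Type*} [Fintype B] (h : ℕ) (S₀ : B → List C) (τ : B → ℕ) (c : C) (b : B) : ℕ :=
  (⌈((Fcnt h S₀ τ c : ℚ) - (Gcnt h S₀ τ c : ℚ) + ((h : ℚ) - (τ b : ℚ))) / (h : ℚ)⌉).toNat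

/-- A configuration `S` is consistent with `S₀`. -/
def Consistent {B C : Type*} [Fintype B] [Fintype C] (h : ℕ) (S₀ S : B → List C) : Prop :=
  ∑ c : C, Mcnt h S₀ (tbt S) c ≤ (Beps (tbt S)).card

/-- `S` is tight (relative to `S₀`): for every color `c` there are exactly `M_c(τ_S)`
nonempty monochrome bins of color `c`. -/
def Tight {B C : Type*} [Fintype B] [Fintype C] (h : ℕ) (S₀ S : B → List C) : Prop :=
  ∀ c : C,
    (Finset.univ.filter (fun b => S b ≠ [] ∧ ∀ x ∈ S b, x = c)).card = Mcnt h S₀ (tbt S) c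

/-- The move `τ ↝_b τ'` on top-border tables (relative to `S₀`). -/
def TBMove {B C : Type*} [Fintype B] [Fintype C] (h : ℕ) (S₀ : B → List C)
    (τ τ' : B → ℕ) (b : B) : Prop :=
  (∀ a, a ≠ b → τ a = τ' a) ∧ 0 < τ b ∧
  τ' b = ((borders (S₀ b)).filter (fun i => i < τ b)).sup id ∧
  ∑ c : C, McntB h S₀ τ c b ≤ (Beps τ).card

/-- The move `τ ↝ τ'`: `τ ↝_b τ'` for some bin `b`. -/
def TBStep {B C : Type*} [Fintype B] [Fintype C] (h : ℕ) (S₀ : B → List C)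
    (τ τ' : B → ℕ) : Prop :=
  ∃ b, TBMove h S₀ τ τ' b

end

namespace WaterSort

section Sums

variable {B : Type*} [Fintype B] {f g : B → ℕ} {a b : B}

theorem sum_add_eq_of_eq_off (hfg : ∀ x, x ≠ b → f x = g x) :
    ∑ x, f x + g b = ∑ x, g x + f b := by
  rw [← Finset.add_sum_erase _ f (Finset.mem_univ b), ← Finset.add_sum_erase _ g (Finset.mem_univ b),
    Finset.sum_congr rfl fun x hx => hfg x (Finset.ne_of_mem_erase hx)]
  ring

theorem sum_add_eq_of_eq_off_pair (hab : a ≠ b) (hfg : ∀ x, x ≠ a → x ≠ b → f x = g x) :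
    ∑ x, f x + (g a + g b) = ∑ x, g x + (f a + f b) := by
  have h₁ := sum_add_eq_of_eq_off (f := f) (g := Function.update f a (g a)) (b := a)
    fun x hx => by simp [hx]
  have h₂ := sum_add_eq_of_eq_off (f := Function.update f a (g a)) (g := g) (b := b) fun x hx => by
    by_cases hxa : x = a
    · simp [hxa]
    · simp [hxa, hfg x hxa hx]
  simp only [Function.update_self, Function.update_of_ne hab.symm] at h₁ h₂
  omega

end Sums

/-- `WaterChain h S t T`: there is a chain of exactly `t` water-moves from `S` to `T`. -/
inductive WaterChain {B C : Type*} (h : ℕ) (S : B → List C) : ℕ → (B → List C) → Prop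
  | refl : WaterChain h S 0 S
  | tail {t : ℕ} {T T' : B → List C} :
      WaterChain h S t T → WaterMove h T T' → WaterChain h S (t + 1) T'

section Chains

variable {B C : Type*} {h : ℕ}

theorem WaterChain.trans {S T U : B → List C} {s t : ℕ} (hST : WaterChain h S s T)
    (hTU : WaterChain h T t U) : WaterChain h S (s + t) U := by
  induction hTU with
  | refl => exact hST
  | tail _ hm ih => exact ih.tail hm

theorem WaterChain.exists_seq {S T : B → List C} {t : ℕ} (hST : WaterChain h S t T) :
    ∃ f : ℕ → B → List C, f 0 = S ∧ (∀ i < t, WaterMove h (f i) (f (i + 1))) ∧ f t = T := by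
  induction hST with
  | refl => exact ⟨fun _ => S, rfl, by simp, rfl⟩
  | @tail t T T' _ hm ih =>
    obtain ⟨f, h0, hf, ht⟩ := ih
    refine ⟨fun i => if i ≤ t then f i else T', by simpa using h0, fun i hi => ?_, by simp⟩
    rcases Nat.lt_succ_iff_lt_or_eq.1 hi with hlt | rfl
    · simpa [hlt.le, Nat.succ_le_of_lt hlt] using hf i hlt
    · simpa [ht] using hm

end Chains

theorem exists_top_run {C : Type*} (L : List C) (t : ℕ) (ht : 0 < t) (htL : t ≤ L.length) :
    ∃ s < t, ∃ d, L.take t = L.take s ++ List.replicate (t - s) d ∧ L[s]? = some d ∧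
      (L.take s).getLast? ≠ some d := by
  induction t with
  | zero => omega
  | succ t ih =>
    have hlt : t < L.length := htL
    by_cases hlast : (L.take t).getLast? = some L[t]
    · have ht0 : 0 < t := by
        rcases Nat.eq_zero_or_pos t with rfl | h0
        · simp at hlast
        · exact h0
      obtain ⟨s, hs, d, htake, hd, hne⟩ := ih ht0 hlt.le
      have hdt : d = L[t] := by
        rw [htake, List.getLast?_append, List.getLast?_replicate, if_neg (by omega)] at hlast
        simpa using hlast
      refine ⟨s, by omega, d, ?_, hd, hne⟩
      rw [List.take_succ_eq_append_getElem hlt, htake, ← hdt, List.append_assoc,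
        ← List.replicate_succ', Nat.succ_sub hs.le]
    · refine ⟨t, by omega, L[t], ?_, by simp, hlast⟩
      rw [List.take_succ_eq_append_getElem hlt]
      simp

section States

variable {B C : Type*}

/-- The configuration whose bin `b` holds the bottom `τ b` units of `S₀ b`, topped with `k b` units
of color `col b`. -/
def conf (S₀ : B → List C) (τ k : B → ℕ) (col : B → C) (b : B) : List C :=
  (S₀ b).take (τ b) ++ List.replicate (k b) (col b)

/-- The number of units of color `c` above the borders. -/
noncomputable def load [Fintype B] (k : B → ℕ) (col : B → C) (c : C) : ℕ :=
  ∑ b, if col b = c then k b else 0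

/-- The total room above the borders in the bins with top color `c`. -/
noncomputable def cap [Fintype B] (h : ℕ) (τ k : B → ℕ) (col : B → C) (c : C) : ℕ :=
  ∑ b, if 0 < k b ∧ col b = c then h - τ b else 0

/-- The number of nonempty monochrome bins of color `c`. -/
noncomputable def mono [Fintype B] (τ k : B → ℕ) (col : B → C) (c : C) : ℕ :=
  (Finset.univ.filter fun b => τ b = 0 ∧ 0 < k b ∧ col b = c).card

/-- The data `τ`, `k`, `col` describe a distribution of the units of `S₀` in which each bin `b`
keeps its part below the border `τ b`; a bin may have been emptied down to its border. -/
structure Coherent [Fintype B] (h : ℕ) (S₀ : B → List C) (τ k : B → ℕ) (col : B → C) : Prop where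
  fit : ∀ b, τ b + k b ≤ h
  next : ∀ b, 0 < τ b → (S₀ b)[τ b]? = some (col b)
  top : ∀ b, ((S₀ b).take (τ b)).getLast? ≠ some (col b)
  load_eq : ∀ c, load k col c = ∑ b, ((S₀ b).drop (τ b)).count c

/-- No nonempty monochrome bin can be drained into the other bins with the same top color. -/
def Packed [Fintype B] (h : ℕ) (τ k : B → ℕ) (col : B → C) : Prop :=
  ∀ e, τ e = 0 → 0 < k e → cap h τ k col (col e) < load k col (col e) + h

variable {h : ℕ} {S₀ : B → List C} {τ k k' : B → ℕ} {col col' : B → C}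

theorem waterMove_conf {a b : B} {m : ℕ} (hba : b ≠ a) (hm : 1 ≤ m) (hkb : k b = k' b + m)
    (hcb : col' b = col b) (ha : τ a = 0 ∧ k a = 0 ∨ 0 < k a ∧ col a = col b)
    (hca : col' a = col b) (hka : k' a = k a + m) (hτa : τ a ≤ (S₀ a).length)
    (hfit : τ a + k' a ≤ h)
    (hmax : (k' b = 0 ∧ ((S₀ b).take (τ b)).getLast? ≠ some (col b)) ∨ τ a + k' a = h)
    (hk : ∀ x, x ≠ b → x ≠ a → k' x = k x) (hcol : ∀ x, x ≠ b → x ≠ a → col' x = col x) :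
    WaterMove h (conf S₀ τ k col) (conf S₀ τ k' col') := by
  have hlen : (conf S₀ τ k' col' a).length = τ a + k' a := by
    simp [conf, hτa]
  refine ⟨b, a, col b, m, hm, hba, ?_, ?_, ?_, hlen.trans_le hfit, ?_, fun x hb hxa => ?_⟩
  · simp [conf, hkb, hcb]
  · rcases ha with ⟨h0, h1⟩ | ⟨h0, h1⟩
    · left; simp [conf, h0, h1]
    · right
      simp [conf, List.getLast?_append, List.getLast?_replicate, h0.ne', h1]
  · rcases ha with ⟨h0, h1⟩ | ⟨h0, h1⟩
    · simp [conf, hka, h0, h1, hca]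
    · simp [conf, hka, h1, hca]
  · rw [hlen]
    exact hmax.imp (fun ⟨h0, h1⟩ => by simpa [conf, h0] using h1) id
  · simp [conf, hk x hb hxa, hcol x hb hxa]

theorem conf_reveal {b : B} {s : ℕ} {d : C} (hb : k b = 0)
    (htake : (S₀ b).take (τ b) = (S₀ b).take s ++ List.replicate (τ b - s) d) :
    conf S₀ (Function.update τ b s) (Function.update k b (τ b - s)) (Function.update col b d) =
      conf S₀ τ k col := by
  funext x
  by_cases hx : x = b
  · subst hx; simp [conf, hb, htake]
  · simp [conf, hx]

variable [Fintype B]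

theorem Coherent.le_length (hc : Coherent h S₀ τ k col) (b : B) : τ b ≤ (S₀ b).length := by
  rcases Nat.eq_zero_or_pos (τ b) with h0 | h0
  · omega
  · exact (List.getElem?_eq_some_iff.1 (hc.next b h0)).1.le

theorem load_le_cap (hfit : ∀ b, τ b + k b ≤ h) (c : C) : load k col c ≤ cap h τ k col c := by
  refine Finset.sum_le_sum fun b _ => ?_
  have := hfit b
  split_ifs <;> grind

theorem cap_eq (c : C) : cap h τ k col c = h * mono τ k col c +
    ∑ b, if 0 < τ b ∧ 0 < k b ∧ col b = c then h - τ b else 0 := by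
  rw [mono, Finset.card_filter, Finset.mul_sum, ← Finset.sum_add_distrib, cap]
  refine Finset.sum_congr rfl fun b _ => ?_
  rcases Nat.eq_zero_or_pos (τ b) with h0 | h0
  · simp [h0]
  · simp [h0, h0.ne']

theorem sum_mono [Fintype C] :
    ∑ c, mono τ k col c = (Finset.univ.filter fun b => τ b = 0 ∧ 0 < k b).card := by
  rw [Finset.card_eq_sum_card_fiberwise (f := col) (t := Finset.univ) (by simp)]
  refine Finset.sum_congr rfl fun c _ => ?_
  simp [mono, Finset.filter_filter, and_assoc]

theorem exists_empty [Fintype C] {c : C}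
    (hagree : ∀ a, 0 < τ a → (0 < k a ↔ 0 < k' a) ∧ col a = col' a)
    (hfull : ∀ d, load k' col' d ≤ cap h τ k' col' d)
    (hlt : cap h τ k col c < load k' col' c)
    (hpacked : ∀ e, τ e = 0 → 0 < k e → cap h τ k col (col e) < load k' col' (col e) + h) :
    ∃ a, τ a = 0 ∧ k a = 0 := by
  by_contra! hne
  have hcap : ∀ d, cap h τ k col d + h * mono τ k' col' d =
      cap h τ k' col' d + h * mono τ k col d := fun d => by
    have : ∀ b, (if 0 < τ b ∧ 0 < k b ∧ col b = d then h - τ b else 0) =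
        if 0 < τ b ∧ 0 < k' b ∧ col' b = d then h - τ b else 0 := fun b => by
      by_cases h0 : 0 < τ b
      · simp [h0, (hagree b h0).1, (hagree b h0).2]
      · simp [h0]
    rw [cap_eq (k := k), cap_eq (k := k')]
    simp only [this]
    omega
  have hle : ∀ d, mono τ k col d ≤ mono τ k' col' d := fun d => by
    rcases Nat.eq_zero_or_pos (mono τ k col d) with h0 | h0
    · omega
    · obtain ⟨e, he⟩ := Finset.card_pos.1 h0
      simp only [Finset.mem_filter, Finset.mem_univ, true_and] at he
      have h1 := hpacked e he.1 he.2.1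
      rw [he.2.2] at h1
      have h2 := hfull d
      have h3 := hcap d
      refine Nat.lt_succ_iff.1 (lt_of_mul_lt_mul_left (a := h) ?_ (Nat.zero_le _))
      rw [Nat.mul_succ]
      omega
  have hlt' : mono τ k col c < mono τ k' col' c := by
    have h2 := hfull c
    have h3 := hcap c
    exact lt_of_mul_lt_mul_left (a := h) (by omega) (Nat.zero_le _)
  have hsum := Finset.sum_lt_sum (fun d _ => hle d) ⟨c, Finset.mem_univ c, hlt'⟩
  rw [sum_mono, sum_mono] at hsum
  refine absurd hsum (not_lt.2 (Finset.card_le_card fun b hb => ?_))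
  simp only [Finset.mem_filter, Finset.mem_univ, true_and] at hb ⊢
  exact ⟨hb.1, Nat.pos_of_ne_zero (hne b hb.1)⟩

/-- A bin whose run of top color fits into the free room of the bins in `A` can be drained. -/
theorem exists_drain (hτ : ∀ a, τ a ≤ (S₀ a).length) {b : B}
    (htop : ((S₀ b).take (τ b)).getLast? ≠ some (col b)) (A : Finset B) :
    ∀ k : B → ℕ, b ∉ A → (∀ a, τ a + k a ≤ h) → (∀ a ∈ A, 0 < k a ∧ col a = col b) →
      k b ≤ ∑ a ∈ A, (h - τ a - k a) →
      ∃ k' : B → ℕ, k' b = 0 ∧ (∀ a, a ≠ b → a ∉ A → k' a = k a) ∧ (∀ a ∈ A, k a ≤ k' a) ∧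
        (∀ a, τ a + k' a ≤ h) ∧ (∀ c, load k' col c = load k col c) ∧
        ∃ t, t ≤ k b ∧ t ≤ A.card ∧ WaterChain h (conf S₀ τ k col) t (conf S₀ τ k' col) := by
  induction A using Finset.induction_on with
  | empty =>
    intro k _ hfit _ hroom
    exact ⟨k, by simpa using hroom, by simp, by simp, hfit, fun _ => rfl, 0, by simp, by simp, .refl⟩
  | insert a A haA ih =>
    intro k hb hfit hA hroom
    rw [Finset.sum_insert haA] at hroom
    simp only [Finset.mem_insert, not_or] at hb
    obtain ⟨hba, hbA⟩ := hb
    obtain ⟨hka, hca⟩ := hA a (Finset.mem_insert_self a A)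
    have hfa := hfit a
    have hcard := Finset.card_insert_of_notMem haA
    have hbin : ∀ x, x ∉ insert a A ↔ x ≠ a ∧ x ∉ A := fun x => by simp
    obtain ⟨m, hm⟩ : ∃ m, m = min (k b) (h - τ a - k a) := ⟨_, rfl⟩
    obtain ⟨k₁, hk₁⟩ : ∃ k₁, k₁ = Function.update (Function.update k b (k b - m)) a (k a + m) :=
      ⟨_, rfl⟩
    have h1b : k₁ b = k b - m := by simp [hk₁, hba]
    have h1a : k₁ a = k a + m := by simp [hk₁]
    have h1 : ∀ x, x ≠ b → x ≠ a → k₁ x = k x := fun x hxb hxa => by simp [hk₁, hxb, hxa]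
    have hload : ∀ c, load k₁ col c = load k col c := fun c => by
      have := sum_add_eq_of_eq_off_pair (f := fun x => if col x = c then k₁ x else 0)
        (g := fun x => if col x = c then k x else 0) hba
        fun x hxb hxa => by simp [h1 x hxb hxa]
      simp only [h1a, h1b, hca] at this
      unfold load
      split_ifs at this <;> omega
    have hroomA : ∑ x ∈ A, (h - τ x - k₁ x) = ∑ x ∈ A, (h - τ x - k x) :=
      Finset.sum_congr rfl fun x hx => by
        rw [h1 x (by grind) (by grind)]
    have hfit₁ : ∀ x, τ x + k₁ x ≤ h := fun x => by
      have := hfit x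
      by_cases hxb : x = b
      · subst hxb; omega
      · by_cases hxa : x = a
        · subst hxa; omega
        · rw [h1 x hxb hxa]; exact this
    obtain ⟨k', h'b, h'off, h'ge, h'fit, h'load, t, htk, htA, hchain⟩ :=
      ih k₁ hbA hfit₁ (fun x hx => by
        rw [h1 x (by grind) (by grind)]; exact hA x (Finset.mem_insert_of_mem hx))
        (by omega)
    have h'a := h'off a (Ne.symm hba) haA
    refine ⟨k', h'b, fun x hxb hx => ?_, fun x hx => ?_, h'fit, fun c => (h'load c).trans (hload c),
      ?_⟩
    · rw [hbin] at hx
      rw [h'off x hxb hx.2, h1 x hxb hx.1]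
    · rcases Finset.mem_insert.1 hx with rfl | hx
      · omega
      · rw [← h1 x (by grind) (by grind)]; exact h'ge x hx
    · rcases Nat.eq_zero_or_pos m with hm0 | hm0
      · have : k₁ = k := by
          subst hm0; simp [hk₁]
        exact ⟨t, by omega, by omega, this ▸ hchain⟩
      · refine ⟨1 + t, by omega, by omega, WaterChain.trans (.tail .refl ?_) hchain⟩
        refine waterMove_conf hba hm0 (by omega) rfl (.inr ⟨hka, hca⟩) hca h1a (hτ a) (hfit₁ a) ?_ h1
          fun _ _ _ => rfl
        rcases Nat.le_total (k b) (h - τ a - k a) with hle | hle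
        · exact .inl ⟨by omega, htop⟩
        · right; omega

theorem Coherent.sum_add_eq [Fintype C] (hc : Coherent h S₀ τ k col) :
    ∑ b, (τ b + k b) = ∑ b, (S₀ b).length := by
  have hload : ∑ c, load k col c = ∑ b, k b := by
    unfold load
    rw [Finset.sum_comm]
    simp
  have hcount : ∑ c, ∑ b, ((S₀ b).drop (τ b)).count c = ∑ b, ((S₀ b).length - τ b) := by
    rw [Finset.sum_comm]
    refine Finset.sum_congr rfl fun b _ => ?_
    rw [← List.length_drop, ← Multiset.coe_card, ← Multiset.sum_count_eq_card (s := Finset.univ)]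
    · simp
    · simp
  rw [Finset.sum_add_distrib, ← hload, Finset.sum_congr rfl fun c _ => hc.load_eq c, hcount,
    ← Finset.sum_add_distrib]
  exact Finset.sum_congr rfl fun b _ => by have := hc.le_length b; omega

theorem sum_length_of_initConfig {n : ℕ} (hInit : InitConfig h S₀)
    (hn : (Finset.univ.filter fun b => (S₀ b).length = h).card = n) :
    ∑ b, (S₀ b).length = h * n := by
  rw [← hn, Finset.card_filter, Finset.mul_sum]
  refine Finset.sum_congr rfl fun b _ => ?_
  rcases hInit b with hb | hb
  · simp [hb]
  · rw [hb]
    split_ifs <;> omega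

theorem Coherent.length_eq (hc : Coherent h S₀ τ k col) (hInit : InitConfig h S₀) {b : B}
    (hb : 0 < τ b) : (S₀ b).length = h := by
  have := hc.le_length b
  rcases hInit b with h0 | h0 <;> omega

theorem Coherent.color_eq (hc : Coherent h S₀ τ k col) (hc' : Coherent h S₀ τ k' col') {b : B}
    (hb : 0 < τ b) : col b = col' b :=
  Option.some.inj ((hc.next b hb).symm.trans (hc'.next b hb))

/-- In a packed state with `n` bins' worth of units, at most `n` bins share a top color. -/
theorem card_top_le [Fintype C] {n : ℕ} (hInit : InitConfig h S₀)
    (hn : (Finset.univ.filter fun b => (S₀ b).length = h).card = n)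
    (hc : Coherent h S₀ τ k col) (hp : Packed h τ k col) (c : C) :
    (Finset.univ.filter fun b => 0 < k b ∧ col b = c).card ≤ n := by
  by_cases hmono : ∃ e, τ e = 0 ∧ 0 < k e ∧ col e = c
  · obtain ⟨e, he0, hek, rfl⟩ := hmono
    have hcap := hp e he0 hek
    have htotal := hc.sum_add_eq.trans (sum_length_of_initConfig hInit hn)
    have hsplit : h * (Finset.univ.filter fun b => 0 < k b ∧ col b = col e).card =
        cap h τ k col (col e) + ∑ b, if 0 < k b ∧ col b = col e then τ b else 0 := by
      rw [Finset.card_filter, Finset.mul_sum, cap, ← Finset.sum_add_distrib]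
      refine Finset.sum_congr rfl fun b _ => ?_
      have := hc.fit b
      split_ifs <;> omega
    have hle : load k col (col e) + (∑ b, if 0 < k b ∧ col b = col e then τ b else 0) ≤
        ∑ b, (τ b + k b) := by
      rw [load, ← Finset.sum_add_distrib]
      refine Finset.sum_le_sum fun b _ => ?_
      split_ifs <;> omega
    refine Nat.lt_succ_iff.1 (lt_of_mul_lt_mul_left (a := h) ?_ (Nat.zero_le _))
    rw [Nat.mul_succ]
    omega
  · push Not at hmono
    rw [← hn]
    refine Finset.card_le_card fun b hb => ?_
    simp only [Finset.mem_filter, Finset.mem_univ, true_and] at hb ⊢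
    refine hc.length_eq hInit (Nat.pos_of_ne_zero fun h0 => ?_)
    exact hmono b h0 hb.1 hb.2

theorem cap_add_of_eq_off {τ' : B → ℕ} {b : B}
    (hoff : ∀ a, a ≠ b → τ' a = τ a ∧ (0 < k' a ↔ 0 < k a) ∧ col' a = col a) (c : C) :
    cap h τ' k' col' c + (if 0 < k b ∧ col b = c then h - τ b else 0) =
      cap h τ k col c + if 0 < k' b ∧ col' b = c then h - τ' b else 0 :=
  sum_add_eq_of_eq_off (f := fun x => if 0 < k' x ∧ col' x = c then h - τ' x else 0)
    (g := fun x => if 0 < k x ∧ col x = c then h - τ x else 0) fun x hx => by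
      obtain ⟨h1, h2, h3⟩ := hoff x hx
      simp only [h1, h2, h3]

theorem Coherent.exists_drain (hc : Coherent h S₀ τ k col) {b : B} (hb : 0 < k b)
    (hroom : load k col (col b) + (h - τ b) ≤ cap h τ k col (col b)) :
    ∃ k', Coherent h S₀ τ k' col ∧ k' b = 0 ∧ (∀ a, a ≠ b → (0 < k' a ↔ 0 < k a)) ∧
      (∀ c, load k' col c = load k col c) ∧
      ∃ t, t ≤ k b ∧ t ≤ (Finset.univ.filter fun a => 0 < k' a ∧ col a = col b).card ∧
        WaterChain h (conf S₀ τ k col) t (conf S₀ τ k' col) := by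
  set A := Finset.univ.filter fun a => a ≠ b ∧ 0 < k a ∧ col a = col b with hA
  have hmem : ∀ a, a ∈ A ↔ a ≠ b ∧ 0 < k a ∧ col a = col b := by simp [hA]
  have hcap : cap h τ k col (col b) = ∑ a ∈ A, (h - τ a) + (h - τ b) := by
    have := sum_add_eq_of_eq_off (b := b)
      (f := fun x => if 0 < k x ∧ col x = col b then h - τ x else 0)
      (g := fun x => if x ≠ b ∧ 0 < k x ∧ col x = col b then h - τ x else 0)
      fun x hx => by simp [hx]
    rw [hA, Finset.sum_filter]
    simpa [cap, hb] using this
  have hload : load k col (col b) = ∑ a ∈ A, k a + k b := by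
    have := sum_add_eq_of_eq_off (b := b) (f := fun x => if col x = col b then k x else 0)
      (g := fun x => if x ≠ b ∧ 0 < k x ∧ col x = col b then k x else 0)
      fun x hx => by
        rcases Nat.eq_zero_or_pos (k x) with h0 | h0 <;> simp [hx, h0]
    rw [hA, Finset.sum_filter]
    simpa [load] using this
  have hfree : ∑ a ∈ A, (h - τ a - k a) + ∑ a ∈ A, k a = ∑ a ∈ A, (h - τ a) := by
    rw [← Finset.sum_add_distrib]
    exact Finset.sum_congr rfl fun a _ => by have := hc.fit a; omega
  obtain ⟨k', h0, hoff, hge, hfit, hl, t, htk, htA, hchain⟩ :=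
    WaterSort.exists_drain hc.le_length (hc.top b) A k (by simp [hmem]) hc.fit
      (fun a ha => ((hmem a).1 ha).2) (by omega)
  refine ⟨k', ⟨hfit, hc.next, hc.top, fun c => (hl c).trans (hc.load_eq c)⟩, h0, fun a ha => ?_, hl,
    t, htk, htA.trans (Finset.card_le_card fun a ha => ?_), hchain⟩
  · by_cases haA : a ∈ A
    · have h1 := ((hmem a).1 haA).2.1
      exact ⟨fun _ => h1, fun _ => h1.trans_le (hge a haA)⟩
    · rw [hoff a ha haA]
  · simp only [Finset.mem_filter, Finset.mem_univ, true_and]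
    exact ⟨((hmem a).1 ha).2.1.trans_le (hge a ha), ((hmem a).1 ha).2.2⟩

/-- If some coherent state has bin `b` emptied down to its border, then so has some packed state
that is cheaply reachable from a given packed state. -/
theorem exists_release [Fintype C] {n : ℕ} (hInit : InitConfig h S₀)
    (hn : (Finset.univ.filter fun b => (S₀ b).length = h).card = n)
    {b : B} (hτb : 0 < τ b)
    (hc' : Coherent h S₀ τ k' col') (hb' : k' b = 0) (hpos' : ∀ a, a ≠ b → 0 < τ a → 0 < k' a)
    (hc : Coherent h S₀ τ k col) (hpos : ∀ a, 0 < τ a → 0 < k a) (hp : Packed h τ k col) :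
    ∃ k₁ col₁, Coherent h S₀ τ k₁ col₁ ∧ k₁ b = 0 ∧ (∀ a, a ≠ b → 0 < τ a → 0 < k₁ a) ∧
      Packed h τ k₁ col₁ ∧
      ∃ t ≤ min h n, WaterChain h (conf S₀ τ k col) t (conf S₀ τ k₁ col₁) := by
  have hkb := hpos b hτb
  have hfb := hc.fit b
  by_cases hroom : load k col (col b) + (h - τ b) ≤ cap h τ k col (col b)
  · obtain ⟨k₁, hc₁, h0, hoff, hl, t, htk, htA, hchain⟩ := hc.exists_drain hkb hroom
    have hp₁ : Packed h τ k₁ col := fun e he hek => by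
      have hne : e ≠ b := fun heq => by rw [heq] at he; omega
      have h1 := hp e he ((hoff e hne).1 hek)
      have h2 := cap_add_of_eq_off (h := h) (τ := τ) (τ' := τ) (col := col) (col' := col)
        (fun a ha => ⟨rfl, hoff a ha, rfl⟩) (col e)
      rw [hl]
      simp only [h0] at h2
      simp at h2
      omega
    exact ⟨k₁, col, hc₁, h0, fun a ha hτa => (hoff a ha).2 (hpos a hτa), hp₁, t,
      le_min (by omega) (htA.trans (card_top_le hInit hn hc₁ hp₁ _)), hchain⟩
  · have hcap := cap_add_of_eq_off (h := h) (τ := τ) (τ' := τ) (k := k)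
      (k' := Function.update k b 0) (col := col) (col' := col) (b := b)
      (fun a ha => ⟨rfl, by simp [ha], rfl⟩)
    simp only [Function.update_self, lt_irrefl, false_and, if_false, add_zero] at hcap
    have hload : ∀ c, load k' col' c = load k col c := fun c =>
      (hc'.load_eq c).trans (hc.load_eq c).symm
    obtain ⟨a, hτa, hka⟩ := exists_empty (h := h) (τ := τ) (k := Function.update k b 0) (k' := k')
      (col := col) (col' := col') (c := col b)
      (fun a ha => ⟨by
        by_cases hab : a = b
        · subst hab; simp [hb']
        · simp [hab, hpos a ha, hpos' a hab ha], hc.color_eq hc' ha⟩)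
      (load_le_cap hc'.fit)
      (by
        have := hcap (col b)
        simp only [hkb, true_and, if_true] at this
        rw [hload]; omega)
      (fun e he hek => by
        have hne : e ≠ b := fun heq => by rw [heq] at he; omega
        rw [Function.update_of_ne hne] at hek
        have := hp e he hek
        have := hcap (col e)
        rw [hload]; omega)
    have hab : a ≠ b := fun heq => by rw [heq] at hτa; omega
    rw [Function.update_of_ne hab] at hka
    obtain ⟨k₁, hk₁⟩ : ∃ k₁, k₁ = Function.update (Function.update k b 0) a (k b) := ⟨_, rfl⟩
    obtain ⟨col₁, hcol₁⟩ : ∃ col₁, col₁ = Function.update col a (col b) := ⟨_, rfl⟩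
    have h1b : k₁ b = 0 := by simp [hk₁, hab.symm]
    have h1a : k₁ a = k b := by simp [hk₁]
    have h1 : ∀ x, x ≠ b → x ≠ a → k₁ x = k x := fun x hxb hxa => by simp [hk₁, hxb, hxa]
    have hc1a : col₁ a = col b := by simp [hcol₁]
    have hc1 : ∀ x, x ≠ a → col₁ x = col x := fun x hxa => by simp [hcol₁, hxa]
    have hl₁ : ∀ c, load k₁ col₁ c = load k col c := fun c => by
      have := sum_add_eq_of_eq_off_pair (f := fun x => if col₁ x = c then k₁ x else 0)
        (g := fun x => if col x = c then k x else 0) hab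
        fun x hxa hxb => by simp [h1 x hxb hxa, hc1 x hxa]
      simp only [h1a, h1b, hc1a, hc1 b hab.symm, hka] at this
      unfold load
      split_ifs at this <;> omega
    have hcap₁ : ∀ c, cap h τ k₁ col₁ c =
        cap h τ (Function.update k b 0) col c + if col b = c then h else 0 := fun c => by
      have := cap_add_of_eq_off (h := h) (τ := τ) (τ' := τ) (k := Function.update k b 0)
        (k' := k₁) (col := col) (col' := col₁) (b := a)
        (fun x hx => ⟨rfl, by simp [hk₁, hx], hc1 x hx⟩) c
      simpa [hab, hka, h1a, hc1a, hτa, hkb] using this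
    have hn1 : 1 ≤ n := by
      rw [← hn]
      exact Finset.card_pos.2 ⟨b, by simpa using hc.length_eq hInit hτb⟩
    refine ⟨k₁, col₁, ⟨fun x => ?_, fun x hx => ?_, fun x => ?_,
      fun c => (hl₁ c).trans (hc.load_eq c)⟩, h1b, fun x hxb hx => ?_, fun e he hek => ?_, 1,
      le_min (by omega) hn1, .tail .refl ?_⟩
    · by_cases hxa : x = a
      · subst hxa; omega
      · by_cases hxb : x = b
        · subst hxb; omega
        · rw [h1 x hxb hxa]; exact hc.fit x
    · rw [hc1 x (fun heq => by rw [heq] at hx; omega)]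
      exact hc.next x hx
    · by_cases hxa : x = a
      · subst hxa; simp [hτa]
      · rw [hc1 x hxa]; exact hc.top x
    · rw [h1 x hxb (fun heq => by rw [heq] at hx; omega)]
      exact hpos x hx
    · have h2 := hcap (col₁ e)
      rw [hcap₁, hl₁]
      by_cases hcol : col b = col₁ e
      · rw [← hcol] at h2 ⊢
        simp only [hkb, true_and, if_true] at h2 ⊢
        omega
      · have hea : e ≠ a := fun heq => hcol (by rw [heq, hc1a])
        have heb : e ≠ b := fun heq => by rw [heq] at he; omega
        rw [h1 e heb hea] at hek
        have := hp e he hek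
        rw [hc1 e hea] at h2 hcol ⊢
        simp only [hcol, if_false, and_false] at h2 ⊢
        omega
    · exact waterMove_conf hab.symm hkb (by omega) (hc1 b hab.symm) (.inl ⟨hτa, hka⟩) hc1a
        (by omega) (by omega) (by omega) (.inl ⟨h1b, hc.top b⟩) h1 fun x _ hxa => hc1 x hxa

section Reveal

variable {b : B} {s : ℕ} {d : C}

theorem load_reveal (hb : k b = 0) (c : C) :
    load (Function.update k b (τ b - s)) (Function.update col b d) c =
      load k col c + if d = c then τ b - s else 0 := by
  have := sum_add_eq_of_eq_off (b := b)
    (f := fun x => if Function.update col b d x = c then Function.update k b (τ b - s) x else 0)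
    (g := fun x => if col x = c then k x else 0) fun x hx => by simp [hx]
  simpa [load, hb] using this

theorem Coherent.reveal (hc : Coherent h S₀ τ k col) (hb : k b = 0) (hs : s < τ b)
    (htake : (S₀ b).take (τ b) = (S₀ b).take s ++ List.replicate (τ b - s) d)
    (hnext : (S₀ b)[s]? = some d) (htop : ((S₀ b).take s).getLast? ≠ some d) :
    Coherent h S₀ (Function.update τ b s) (Function.update k b (τ b - s))
      (Function.update col b d) := by
  refine ⟨fun x => ?_, fun x hx => ?_, fun x => ?_, fun c => ?_⟩
  · have := hc.fit x
    by_cases hxb : x = b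
    · subst hxb; simp only [Function.update_self]; omega
    · simpa [hxb] using this
  · by_cases hxb : x = b
    · subst hxb; simpa using hnext
    · simp only [Function.update_of_ne hxb] at hx ⊢
      exact hc.next x hx
  · by_cases hxb : x = b
    · subst hxb; simpa using htop
    · simp only [Function.update_of_ne hxb]
      exact hc.top x
  · have hsum := sum_add_eq_of_eq_off (b := b)
      (f := fun x => ((S₀ x).drop (Function.update τ b s x)).count c)
      (g := fun x => ((S₀ x).drop (τ x)).count c) fun x hx => by simp [hx]
    have h1 : (S₀ b).count c = ((S₀ b).take s).count c + ((S₀ b).drop s).count c := by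
      rw [← List.count_append, List.take_append_drop]
    have h2 : (S₀ b).count c = ((S₀ b).take (τ b)).count c + ((S₀ b).drop (τ b)).count c := by
      rw [← List.count_append, List.take_append_drop]
    rw [htake, List.count_append, List.count_replicate] at h2
    simp only [beq_iff_eq] at h2
    rw [load_reveal hb, hc.load_eq]
    simp only [Function.update_self] at hsum
    omega

/-- After uncovering the next run of a bin that was emptied down to its border, a packed state is
reached by draining at most one monochrome bin. -/
theorem exists_packed_reveal [Fintype C] {n : ℕ} (hInit : InitConfig h S₀)
    (hn : (Finset.univ.filter fun b => (S₀ b).length = h).card = n)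
    (hc : Coherent h S₀ τ k col) (hb : k b = 0) (hpos : ∀ a, a ≠ b → 0 < τ a → 0 < k a)
    (hp : Packed h τ k col) (hs : s < τ b)
    (htake : (S₀ b).take (τ b) = (S₀ b).take s ++ List.replicate (τ b - s) d)
    (hnext : (S₀ b)[s]? = some d) (htop : ((S₀ b).take s).getLast? ≠ some d) :
    ∃ k₂ col₂, Coherent h S₀ (Function.update τ b s) k₂ col₂ ∧
      (∀ a, 0 < Function.update τ b s a → 0 < k₂ a) ∧
      Packed h (Function.update τ b s) k₂ col₂ ∧
      ∃ t ≤ min h n,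
        WaterChain h (conf S₀ τ k col) t (conf S₀ (Function.update τ b s) k₂ col₂) := by
  have hc₁ := hc.reveal hb hs htake hnext htop
  have hload₁ := load_reveal (τ := τ) (s := s) (col := col) (d := d) hb
  have hconf := conf_reveal (col := col) hb htake
  have hcap₁ : ∀ c, cap h (Function.update τ b s) (Function.update k b (τ b - s))
      (Function.update col b d) c = cap h τ k col c + if d = c then h - s else 0 := fun c => by
    have := cap_add_of_eq_off (h := h) (τ := τ) (τ' := Function.update τ b s) (k := k)
      (k' := Function.update k b (τ b - s)) (col := col) (col' := Function.update col b d)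
      (b := b) (fun a ha => by simp [ha]) c
    simpa [hb, hs] using this
  have hfb := hc.fit b
  have hoff : ∀ x, x ≠ b → Function.update τ b s x = τ x ∧
      Function.update k b (τ b - s) x = k x ∧ Function.update col b d x = col x :=
    fun x hx => by simp [hx]
  have hselfk : Function.update k b (τ b - s) b = τ b - s := by simp
  have hselfcol : Function.update col b d b = d := by simp
  generalize Function.update τ b s = τ₁ at *
  generalize Function.update k b (τ b - s) = k₁ at *
  generalize Function.update col b d = col₁ at *
  have hpos₁ : ∀ a, 0 < τ₁ a → 0 < k₁ a := fun a ha => by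
    by_cases hab : a = b
    · subst hab; omega
    · obtain ⟨h1, h2, -⟩ := hoff a hab
      rw [h1] at ha
      rw [h2]
      exact hpos a hab ha
  have hold : ∀ e, e ≠ b → τ₁ e = 0 → 0 < k₁ e →
      cap h τ k col (col₁ e) < load k col (col₁ e) + h := fun e heb he hek => by
    obtain ⟨h1, h2, h3⟩ := hoff e heb
    rw [h3]
    exact hp e (h1 ▸ he) (h2 ▸ hek)
  by_cases hp₁ : Packed h τ₁ k₁ col₁
  · exact ⟨k₁, col₁, hc₁, hpos₁, hp₁, 0, Nat.zero_le _, hconf ▸ .refl⟩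
  · unfold Packed at hp₁
    push Not at hp₁
    obtain ⟨e, he, hek, hroom⟩ := hp₁
    have hed : col₁ e = d := by
      by_contra hne
      have heb : e ≠ b := fun heq => hne (heq ▸ hselfcol)
      have := hold e heb he hek
      rw [hcap₁, hload₁, if_neg (Ne.symm hne), if_neg (Ne.symm hne)] at hroom
      omega
    obtain ⟨k₂, hc₂, h0, hiff, hl, t, htk, htA, hchain⟩ := hc₁.exists_drain hek (by omega)
    have hp₂ : Packed h τ₁ k₂ col₁ := fun x hx hxk => by
      have hxe : x ≠ e := fun heq => by rw [heq] at hxk; omega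
      have hxk₁ := (hiff x hxe).1 hxk
      have hcap₂ := cap_add_of_eq_off (h := h) (τ := τ₁) (τ' := τ₁) (col := col₁) (col' := col₁)
        (fun a ha => ⟨rfl, hiff a ha, rfl⟩) (col₁ x)
      simp only [h0, lt_irrefl, false_and, if_false, hek, true_and, he, hed] at hcap₂
      rw [hl]
      have h1 := hcap₁ (col₁ x)
      have h2 := hload₁ (col₁ x)
      by_cases hxd : d = col₁ x
      · have h3 : cap h τ k col (col₁ x) < load k col (col₁ x) + h := by
          by_cases hxb : x = b
          · rw [← hxd, ← hed]
            exact hold e (fun heb => hxe (hxb.trans heb.symm)) he hek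
          · exact hold x hxb hx hxk₁
        simp only [hxd, if_true] at h1 h2 hcap₂
        omega
      · have h3 := hold x (fun heq => hxd (by rw [heq, hselfcol])) hx hxk₁
        simp only [hxd, if_false] at h1 h2 hcap₂
        omega
    refine ⟨k₂, col₁, hc₂, fun a ha => ?_, hp₂, t, le_min ?_ ?_, hconf ▸ hchain⟩
    · have hae : a ≠ e := fun heq => by rw [heq] at ha; omega
      exact (hiff a hae).2 (hpos₁ a ha)
    · have := hc₁.fit e
      omega
    · exact htA.trans (card_top_le hInit hn hc₂ hp₂ _)

end Reveal

/-- A water-move keeps all borders, except that its source may be emptied down to its border. -/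
theorem Coherent.of_waterMove (hc : Coherent h S₀ τ k col) (hpos : ∀ a, 0 < τ a → 0 < k a)
    {S : B → List C} (hS : WaterMove h (conf S₀ τ k col) S) :
    ∃ k' col' b, S = conf S₀ τ k' col' ∧ Coherent h S₀ τ k' col' ∧
      ∀ a, a ≠ b → 0 < τ a → 0 < k' a := by
  obtain ⟨b, a, c, m, hm, hba, hsrc, htgt, hadd, hlen, -, hoff⟩ := hS
  have hkb : 0 < k b := by
    by_contra h0
    have hτb : τ b = 0 := by
      by_contra h1
      exact h0 (hpos b (Nat.pos_of_ne_zero h1))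
    have := congrArg List.length hsrc
    simp only [conf, hτb, Nat.eq_zero_of_not_pos h0, List.take_zero, List.replicate_zero,
      List.append_nil, List.length_nil, List.length_append, List.length_replicate] at this
    omega
  have hcb : col b = c := by
    have := congrArg List.getLast? hsrc
    simpa [conf, List.getLast?_append, List.getLast?_replicate, hkb.ne',
      (Nat.lt_of_lt_of_le Nat.zero_lt_one hm).ne'] using this
  have hmk : m ≤ k b := by
    by_contra! hlt
    obtain ⟨j, rfl⟩ : ∃ j, m = (j + 1) + k b := ⟨m - k b - 1, by omega⟩
    rw [conf, List.replicate_add, ← List.append_assoc, hcb] at hsrc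
    have := List.append_cancel_right hsrc
    refine hc.top b ?_
    rw [this, hcb]
    simp [List.getLast?_append, List.getLast?_replicate]
  have hSb : S b = (S₀ b).take (τ b) ++ List.replicate (k b - m) c := by
    have h1 : List.replicate (k b) c = List.replicate (k b - m) c ++ List.replicate m c := by
      rw [← List.replicate_add, Nat.sub_add_cancel hmk]
    rw [conf, hcb, h1, ← List.append_assoc] at hsrc
    exact (List.append_cancel_right hsrc).symm
  have htgt' : τ a = 0 ∧ k a = 0 ∨ 0 < k a ∧ col a = c := by
    rcases Nat.eq_zero_or_pos (k a) with h0 | h0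
    · refine .inl ⟨?_, h0⟩
      by_contra h1
      have := hpos a (Nat.pos_of_ne_zero h1)
      omega
    · refine .inr ⟨h0, ?_⟩
      rcases htgt with h1 | h1
      · have := congrArg List.length h1
        simp only [conf, List.length_append, List.length_replicate, List.length_nil] at this
        omega
      · simpa [conf, List.getLast?_append, List.getLast?_replicate, h0.ne'] using h1
  have hSa : S a = (S₀ a).take (τ a) ++ List.replicate (k a + m) c := by
    rw [hadd, conf]
    rcases htgt' with ⟨h0, h1⟩ | ⟨_, h1⟩
    · simp [h0, h1]
    · simp [h1]
  have hfa : τ a + (k a + m) ≤ h := by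
    rw [hSa] at hlen
    simpa [hc.le_length a] using hlen
  obtain ⟨k', hk'⟩ : ∃ k', k' = Function.update (Function.update k b (k b - m)) a (k a + m) :=
    ⟨_, rfl⟩
  obtain ⟨col', hcol'⟩ : ∃ col', col' = Function.update col a c := ⟨_, rfl⟩
  have h1b : k' b = k b - m := by simp [hk', hba]
  have h1a : k' a = k a + m := by simp [hk']
  have h1 : ∀ x, x ≠ b → x ≠ a → k' x = k x := fun x hxb hxa => by simp [hk', hxb, hxa]
  have hc1a : col' a = c := by simp [hcol']
  have hc1 : ∀ x, x ≠ a → col' x = col x := fun x hxa => by simp [hcol', hxa]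
  have hsame : 0 < τ a → col a = c := fun h0 => by
    rcases htgt' with h2 | h2
    · omega
    · exact h2.2
  refine ⟨k', col', b, funext fun x => ?_, ⟨fun x => ?_, fun x hx => ?_, fun x => ?_, fun e => ?_⟩,
    fun x hxb hx => ?_⟩
  · by_cases hxa : x = a
    · subst hxa; rw [hSa, conf, h1a, hc1a]
    · by_cases hxb : x = b
      · subst hxb; rw [hSb, conf, h1b, hc1 x hxa, hcb]
      · rw [hoff x hxb hxa, conf, conf, h1 x hxb hxa, hc1 x hxa]
  · have := hc.fit x
    by_cases hxa : x = a
    · subst hxa; omega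
    · by_cases hxb : x = b
      · subst hxb; omega
      · rw [h1 x hxb hxa]; exact this
  · by_cases hxa : x = a
    · subst hxa; rw [hc1a, ← hsame hx]; exact hc.next x hx
    · rw [hc1 x hxa]; exact hc.next x hx
  · by_cases hxa : x = a
    · subst hxa
      rcases Nat.eq_zero_or_pos (τ x) with h0 | h0
      · simp [h0]
      · rw [hc1a, ← hsame h0]; exact hc.top x
    · rw [hc1 x hxa]; exact hc.top x
  · rw [← hc.load_eq]
    have := sum_add_eq_of_eq_off_pair (f := fun x => if col' x = e then k' x else 0)
      (g := fun x => if col x = e then k x else 0) hba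
      fun x hxb hxa => by simp [h1 x hxb hxa, hc1 x hxa]
    simp only [h1a, h1b, hc1a, hc1 b hba, hcb] at this
    unfold load
    rcases htgt' with ⟨_, h2⟩ | ⟨_, h2⟩
    · simp only [h2] at this
      split_ifs at this <;> omega
    · simp only [h2] at this
      split_ifs at this <;> omega
  · have := hpos x hx
    by_cases hxa : x = a
    · subst hxa; omega
    · rw [h1 x hxb hxa]; exact this

/-- An initial configuration is a packed state. -/
theorem exists_initial_state [Nonempty C] (hh : 1 ≤ h) (hInit : InitConfig h S₀) :
    ∃ τ k col, S₀ = conf S₀ τ k col ∧ Coherent h S₀ τ k col ∧ (∀ a, 0 < τ a → 0 < k a) ∧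
      Packed h τ k col ∧ ∀ b, τ b ≤ if (S₀ b).length = h then h - 1 else 0 := by
  have hrun : ∀ b, ∃ (s j : ℕ) (d : C), S₀ b = (S₀ b).take s ++ List.replicate j d ∧
      s + j = (S₀ b).length ∧ (0 < s → (S₀ b)[s]? = some d) ∧
      ((S₀ b).take s).getLast? ≠ some d ∧ (S₀ b).drop s = List.replicate j d ∧
      (0 < (S₀ b).length → 0 < j) := fun b => by
    rcases hInit b with hb | hb
    · obtain ⟨s, hs, d, htake, hd, htop⟩ :=
        exists_top_run (S₀ b) (S₀ b).length (by omega) le_rfl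
      rw [List.take_length] at htake
      refine ⟨s, (S₀ b).length - s, d, htake, by omega, fun _ => hd, htop, ?_, by omega⟩
      refine List.append_cancel_left (as := (S₀ b).take s) ?_
      rw [List.take_append_drop]
      exact htake
    · refine ⟨0, 0, Classical.arbitrary C, ?_, by omega, by omega, by simp, ?_, by omega⟩ <;>
        simp [List.eq_nil_of_length_eq_zero hb]
  choose τ k col hconf hlen hnext htop hdrop hkpos using hrun
  have hle : ∀ b, (S₀ b).length ≤ h := fun b => by rcases hInit b with hb | hb <;> omega
  refine ⟨τ, k, col, funext hconf, ⟨fun b => (hlen b).trans_le (hle b), hnext, htop, fun c => ?_⟩,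
    fun a ha => hkpos a (by have := hlen a; omega), fun e _ _ => ?_, fun b => ?_⟩
  · refine Finset.sum_congr rfl fun b _ => ?_
    rw [hdrop, List.count_replicate]
    simp
  · have : cap h τ k col (col e) ≤ load k col (col e) := Finset.sum_le_sum fun b _ => by
      have h1 := hlen b
      rcases hInit b with hb | hb
      · split_ifs <;> grind
      · split_ifs <;> grind
    omega
  · have h1 := hlen b
    have h2 := hkpos b
    rcases hInit b with hb | hb
    · rw [if_pos hb]; omega
    · rw [hb] at h1; omega

/-- Every reachable configuration is matched by a packed state with the same borders that is
reachable within the bound. -/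
theorem exists_packed_of_reachable [Fintype C] [Nonempty C] {n : ℕ} (hh : 1 ≤ h)
    (hInit : InitConfig h S₀)
    (hn : (Finset.univ.filter fun b => (S₀ b).length = h).card = n)
    {S : B → List C} (hS : Relation.ReflTransGen (WaterMove h) S₀ S) :
    ∃ τ k col, S = conf S₀ τ k col ∧ Coherent h S₀ τ k col ∧ (∀ a, 0 < τ a → 0 < k a) ∧
      ∃ k' col', Coherent h S₀ τ k' col' ∧ (∀ a, 0 < τ a → 0 < k' a) ∧ Packed h τ k' col' ∧
        ∃ t, t + 2 * min h n * ∑ b, τ b ≤ 2 * min h n * ((h - 1) * n) ∧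
          WaterChain h S₀ t (conf S₀ τ k' col') := by
  induction hS with
  | refl =>
    obtain ⟨τ, k, col, hconf, hc, hpos, hp, hτ⟩ := exists_initial_state hh hInit
    refine ⟨τ, k, col, hconf, hc, hpos, k, col, hc, hpos, hp, 0, ?_, hconf ▸ .refl⟩
    rw [zero_add]
    refine Nat.mul_le_mul_left _ ((Finset.sum_le_sum fun b _ => hτ b).trans ?_)
    rw [← Finset.sum_filter, Finset.sum_const, hn, smul_eq_mul, mul_comm]
  | tail _ hmove ih =>
    obtain ⟨τ, k, col, rfl, hc, hpos, kR, colR, hcR, hposR, hpR, t, ht, hchain⟩ := ih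
    obtain ⟨k', col', b, rfl, hc', hpos'⟩ := hc.of_waterMove hpos hmove
    by_cases hb : 0 < τ b ∧ k' b = 0
    · obtain ⟨hτb, hb0⟩ := hb
      obtain ⟨s, hs, d, htake, hnext, htop⟩ :=
        exists_top_run (S₀ b) (τ b) hτb (hc.le_length b)
      obtain ⟨k₁, col₁, hc₁, h1b, hpos₁, hp₁, t₁, ht₁, hchain₁⟩ :=
        exists_release hInit hn hτb hc' hb0 hpos' hcR hposR hpR
      obtain ⟨k₂, col₂, hc₂, hpos₂, hp₂, t₂, ht₂, hchain₂⟩ :=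
        exists_packed_reveal hInit hn hc₁ h1b hpos₁ hp₁ hs htake hnext htop
      refine ⟨_, _, _, (conf_reveal hb0 htake).symm, hc'.reveal hb0 hs htake hnext htop,
        fun a ha => ?_, k₂, col₂, hc₂, hpos₂, hp₂, t + t₁ + t₂, ?_,
        (hchain.trans hchain₁).trans hchain₂⟩
      · by_cases hab : a = b
        · subst hab; simpa using hs
        · rw [Function.update_of_ne hab] at ha ⊢
          exact hpos' a hab ha
      · have hsum := sum_add_eq_of_eq_off (b := b) (f := Function.update τ b s) (g := τ)
          fun x hx => by simp [hx]
        rw [Function.update_self] at hsum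
        have : 2 * min h n * (∑ x, Function.update τ b s x + 1) ≤ 2 * min h n * ∑ x, τ x :=
          Nat.mul_le_mul_left _ (by omega)
        rw [mul_add, mul_one] at this
        omega
    · refine ⟨τ, k', col', rfl, hc', fun a ha => ?_, kR, colR, hcR, hposR, hpR, t, ht, hchain⟩
      by_cases hab : a = b
      · subst hab
        by_contra h0
        exact hb ⟨ha, by omega⟩
      · exact hpos' a hab ha

/-- A packed state with the borders of a sorted configuration is itself sorted. -/
theorem sortedConfig_of_packed (hT : SortedConfig h (conf S₀ τ k col))
    (hc : Coherent h S₀ τ k col) (hpos : ∀ a, 0 < τ a → 0 < k a)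
    (hc' : Coherent h S₀ τ k' col') (hp : Packed h τ k' col') :
    SortedConfig h (conf S₀ τ k' col') := by
  have hτ : ∀ b, τ b = 0 := fun b => by
    by_contra h0
    have hk := hpos b (Nat.pos_of_ne_zero h0)
    rcases hT b with hb | ⟨c, hb⟩
    · have := congrArg List.length hb
      simp only [conf, List.length_append, List.length_replicate, List.length_nil] at this
      omega
    · obtain ⟨x, hx⟩ : ∃ x, ((S₀ b).take (τ b)).getLast? = some x := by
        rw [← Option.isSome_iff_exists, List.getLast?_isSome]
        have := hc.le_length b
        intro hnil
        have := congrArg List.length hnil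
        simp only [List.length_take, List.length_nil] at this
        omega
      have hmem : ∀ y ∈ conf S₀ τ k col b, y = c := fun y hy =>
        List.eq_of_mem_replicate (hb ▸ hy)
      have hxc := hmem x (List.mem_append_left _ (List.mem_of_getLast? hx))
      have hcc := hmem (col b) (List.mem_append_right _ (by simp [hk.ne']))
      exact hc.top b (by rw [hx, hxc, hcc])
  have hk : ∀ b, h ∣ k b := fun b => by
    rcases hT b with hb | ⟨c, hb⟩
    all_goals
      have := congrArg List.length hb
      simp only [conf, hτ, List.take_zero, List.nil_append, List.length_replicate,
        List.length_nil] at this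
      simp [this]
  intro e
  rcases Nat.eq_zero_or_pos (k' e) with h0 | h0
  · left; simp [conf, hτ, h0]
  · refine .inr ⟨col' e, ?_⟩
    have hlt := hp e (hτ e) h0
    have hle := load_le_cap (col := col') hc'.fit (col' e)
    have hdl : h ∣ load k' col' (col' e) := by
      rw [hc'.load_eq, ← hc.load_eq]
      exact Finset.dvd_sum fun b _ => by split_ifs <;> simp [hk]
    have hdc : h ∣ cap h τ k' col' (col' e) :=
      Finset.dvd_sum fun b _ => by split_ifs <;> simp [hτ]
    have heq : load k' col' (col' e) = cap h τ k' col' (col' e) := by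
      have := Nat.eq_zero_of_dvd_of_lt (Nat.dvd_sub hdc hdl) (by omega)
      omega
    have hterm := (Finset.sum_eq_sum_iff_of_le (s := Finset.univ)
      (f := fun b => if col' b = col' e then k' b else 0)
      (g := fun b => if 0 < k' b ∧ col' b = col' e then h - τ b else 0) fun b _ => by
        have := hc'.fit b
        split_ifs <;> grind).1 heq e (Finset.mem_univ e)
    simp only [h0, hτ, if_true, and_self, Nat.sub_zero] at hterm
    simp [conf, hτ, hterm]

end States

end WaterSort

/-- every yes-instance of the water sort puzzle with `n` full bins has a sorting
sequence of at most `2·(h − 1)·n·min(h,n)` water-moves. -/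
theorem statement_9 {B C : Type*} [Fintype B] [Fintype C] (h : ℕ) (hh : 1 ≤ h)
    (S₀ : B → List C) (hInit : InitConfig h S₀) (n : ℕ)
    (hn : (Finset.univ.filter (fun b : B => (S₀ b).length = h)).card = n)
    (hsolv : ∃ T : B → List C, SortedConfig h T ∧ Relation.ReflTransGen (WaterMove h) S₀ T) :
    ∃ ℓ ≤ 2 * (h - 1) * n * min h n, ∃ f : ℕ → B → List C,
      f 0 = S₀ ∧ (∀ i < ℓ, WaterMove h (f i) (f (i + 1))) ∧ SortedConfig h (f ℓ) := by
  rcases isEmpty_or_nonempty C with hC | hC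
  · exact ⟨0, Nat.zero_le _, fun _ => S₀, rfl, by simp, fun b => .inl (Subsingleton.elim _ _)⟩
  obtain ⟨T, hT, hreach⟩ := hsolv
  obtain ⟨τ, k, col, rfl, hc, hpos, k', col', hc', -, hp, t, ht, hchain⟩ :=
    WaterSort.exists_packed_of_reachable hh hInit hn hreach
  obtain ⟨f, h0, hf, hft⟩ := hchain.exists_seq
  refine ⟨t, ?_, f, h0, hf, hft ▸ WaterSort.sortedConfig_of_packed hT hc hpos hc' hp⟩
  calc t ≤ 2 * min h n * ((h - 1) * n) := le_of_add_le_left ht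
    _ = 2 * (h - 1) * n * min h n := by ring
end

section
/- If h = 2, each color of C occurs exactly twice among the units of the initial configuration S (so there are |C| full bins), and S has at least 2 empty bins, then S can reach a sorted configuration by water-moves. -/
open scoped Classical

noncomputable section

/-- The indegree of the color `c` in the directed multigraph `G⃗(S)` (capacity 2): the number
of full bins whose top unit has color `c`. -/
def indeg {B C : Type*} [Fintype B] (S : B → List C) (c : C) : ℕ :=
  (Finset.univ.filter (fun b => (S b).length = 2 ∧ (S b)[1]? = some c)).card

/-- The outdegree of the color `c` in `G⃗(S)` (capacity 2): the number of full bins whose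
bottom unit has color `c`. -/
def outdeg {B C : Type*} [Fintype B] (S : B → List C) (c : C) : ℕ :=
  (Finset.univ.filter (fun b => (S b).length = 2 ∧ (S b)[0]? = some c)).card

/-- A set `A` of bins forms a directed cycle of `G⃗(S)` that is not a self-loop: the bins of
`A` can be arranged in a cyclic order of length at least 2 in which the top color of each bin
is the bottom color of the next. -/
def IsCycleSet {B C : Type*} (S : B → List C) (A : Finset B) : Prop :=
  ∃ l : List B, l.Nodup ∧ l.toFinset = A ∧ 2 ≤ l.length ∧
    (∀ b ∈ l, (S b).length = 2) ∧
    List.Chain' (fun b b' => (S b)[1]? = (S b')[0]?) l ∧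
    ∀ bl ∈ l.getLast?, ∀ bh ∈ l.head?, (S bl)[1]? = (S bh)[0]?

/-- `p_S`: the number of directed cycles of `G⃗(S)` that are not self-loops (each such cycle
being identified with its set of bins/edges). -/
def pS {B C : Type*} [Fintype B] [DecidableEq B] (S : B → List C) : ℕ :=
  (Finset.univ.filter (fun A : Finset B => IsCycleSet S A)).card

/-- `q_S`: the number of vertices of indegree 2 in `G⃗(S)`. -/
def qS {B C : Type*} [Fintype B] [Fintype C] (S : B → List C) : ℕ :=
  (Finset.univ.filter (fun c : C => indeg S c = 2)).card

/-- `r_S`: the number of colors that are not sorted (the two units of the color do not lie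
in the same bin). -/
def rS {B C : Type*} [Fintype B] [Fintype C] [DecidableEq C] (S : B → List C) : ℕ :=
  (Finset.univ.filter (fun c : C => ¬ ∃ b, (S b).count c = 2)).card

/-- Adjacency in the underlying undirected multigraph `G(S)`: some full bin joins `c` and
`c'`. -/
def adj {B C : Type*} (S : B → List C) (c c' : C) : Prop :=
  ∃ b, S b = [c, c'] ∨ S b = [c', c]

/-- The number of connected components (cycles) of the underlying multigraph `G(S)` on the
color set. -/
def numComponents {B C : Type*} [Fintype C] (S : B → List C) : ℕ :=
  (Finset.univ.image
    (fun c : C => Finset.univ.filter (fun c' => Relation.ReflTransGen (adj S) c c'))).card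

end

/-- Whether a bin holds two units of different colors, as a number. -/
def mixedUnits {C : Type*} [DecidableEq C] : List C → ℕ
  | [x, y] => if x = y then 0 else 1
  | _ => 0

theorem mixedUnits_nil {C : Type*} [DecidableEq C] : mixedUnits ([] : List C) = 0 := rfl

theorem mixedUnits_singleton {C : Type*} [DecidableEq C] (x : C) : mixedUnits [x] = 0 := rfl

theorem mixedUnits_pair {C : Type*} [DecidableEq C] (x y : C) :
    mixedUnits [x, y] = if x = y then 0 else 1 := rfl

/-- A single unit may be poured into an empty bin or onto a unit of its own
color, provided that the unit below it has another color. -/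
theorem waterMove_update {B C : Type*} [DecidableEq B] {S : B → List C} {b d : B}
    {l r : List C} {c : C} (hbd : b ≠ d) (hb : S b = l ++ [c]) (hd : S d = r)
    (hr : r = [] ∨ r = [c]) (hl : l.getLast? ≠ some c) :
    WaterMove 2 S (Function.update (Function.update S b l) d (r ++ [c])) := by
  refine ⟨b, d, c, 1, le_rfl, hbd, ?_, ?_, ?_, ?_, ?_, ?_⟩
  · simp [Function.update_of_ne hbd, hb]
  · rcases hr with rfl | rfl <;> simp [hd]
  · simp [hd]
  · rcases hr with rfl | rfl <;> simp
  · left; simpa [Function.update_of_ne hbd] using hl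
  · intro a h₁ h₂
    simp [Function.update_of_ne h₁, Function.update_of_ne h₂]

theorem sum_update_add {B α : Type*} [Fintype B] [DecidableEq B] (f : α → ℕ) (S : B → α)
    (b : B) (v : α) :
    ∑ a, f (Function.update S b v a) + f (S b) = ∑ a, f (S a) + f v := by
  rw [← Finset.add_sum_erase _ _ (Finset.mem_univ b),
    ← Finset.add_sum_erase (a := b) _ (fun a => f (S a)) (Finset.mem_univ b)]
  have : ∑ a ∈ Finset.univ.erase b, f (Function.update S b v a)
      = ∑ a ∈ Finset.univ.erase b, f (S a) :=
    Finset.sum_congr rfl fun a ha => by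
      rw [Function.update_of_ne (Finset.ne_of_mem_erase ha)]
  rw [this, Function.update_self]
  omega

theorem sum_update_update {B α : Type*} [Fintype B] [DecidableEq B] (f : α → ℕ) (S : B → α)
    {b d : B} (hbd : b ≠ d) (v w : α) :
    ∑ a, f (Function.update (Function.update S b v) d w a) + f (S b) + f (S d)
      = ∑ a, f (S a) + f v + f w := by
  have h₁ := sum_update_add f (Function.update S b v) d w
  have h₂ := sum_update_add f S b v
  rw [Function.update_of_ne hbd.symm] at h₁
  omega

/-- If a color occurs twice and one of its units is alone in the bin `b`, then the other unit
lies in another bin, together with no further unit of that color. -/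
theorem exists_other_unit {B C : Type*} [Fintype B] [DecidableEq B] [DecidableEq C]
    {S : B → List C} {x : C} (hx : ∑ a, (S a).count x = 2) {b : B} (hb : S b = [x]) :
    ∃ d, d ≠ b ∧ (S d).count x = 1 := by
  have h := Finset.add_sum_erase Finset.univ (fun a => (S a).count x) (Finset.mem_univ b)
  have hs : ∑ a ∈ Finset.univ.erase b, (S a).count x = 1 := by
    simp only [hb, hx, List.count_singleton_self] at h
    omega
  obtain ⟨d, hd, hne⟩ := Finset.exists_ne_zero_of_sum_ne_zero (hs.trans_ne one_ne_zero)
  have hle := Finset.single_le_sum (f := fun a => (S a).count x) (fun _ _ => Nat.zero_le _) hd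
  refine ⟨d, Finset.ne_of_mem_erase hd, ?_⟩
  simp only [hs] at hle
  omega

/-- By induction on the number of bins holding two different colors, the two kinds of
configurations met while sorting can be sorted: either all bins are full or empty and two
of them are empty, or exactly two bins are half full and some bin is empty. -/
theorem exists_sorted_of_sum_mixedUnits {B C : Type*} [Fintype B] [DecidableEq B]
    [DecidableEq C] (n : ℕ) :
    (∀ S : B → List C, ∑ a, mixedUnits (S a) = n → InitConfig 2 S →
      (∀ c, ∑ a, (S a).count c = 2) → (∃ e f, e ≠ f ∧ S e = [] ∧ S f = []) →
      ∃ T, SortedConfig 2 T ∧ Relation.ReflTransGen (WaterMove 2) S T) ∧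
    (∀ S : B → List C, ∑ a, mixedUnits (S a) = n → (∀ c, ∑ a, (S a).count c = 2) →
      ∀ b d e x y, b ≠ d → S b = [x] → S d = [y] → S e = [] →
      (∀ a, a ≠ b → a ≠ d → (S a).length = 2 ∨ (S a).length = 0) →
      ∃ T, SortedConfig 2 T ∧ Relation.ReflTransGen (WaterMove 2) S T) := by
  induction n using Nat.strong_induction_on with
  | _ n ih =>
    have full : ∀ S : B → List C, ∑ a, mixedUnits (S a) = n → InitConfig 2 S →
        (∀ c, ∑ a, (S a).count c = 2) → (∃ e f, e ≠ f ∧ S e = [] ∧ S f = []) →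
        ∃ T, SortedConfig 2 T ∧ Relation.ReflTransGen (WaterMove 2) S T := by
      rintro S hn hinit hcount ⟨e, f, hef, he, hf⟩
      by_cases hs : SortedConfig 2 S
      · exact ⟨S, hs, .refl⟩
      simp only [SortedConfig, not_forall, not_or, not_exists] at hs
      obtain ⟨b, hb₀, hb₁⟩ := hs
      obtain ⟨x, c, hb⟩ := List.length_eq_two.1
        ((hinit b).resolve_right fun h => hb₀ (List.length_eq_zero_iff.1 h))
      have hxc : x ≠ c := by
        rintro rfl
        exact hb₁ x (by simp [hb, List.replicate])
      have hbe : b ≠ e := by rintro rfl; simp [hb] at he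
      have hbf : b ≠ f := by rintro rfl; simp [hb] at hf
      have hmove := waterMove_update (l := [x]) hbe hb he (.inl rfl) (by simpa using hxc)
      have hmix := sum_update_update mixedUnits S hbe [x] [c]
      simp only [hb, he, mixedUnits_nil, mixedUnits_singleton, mixedUnits_pair,
        if_neg hxc, hn] at hmix
      obtain ⟨T, hT, hreach⟩ := (ih _ (by omega)).2
        (Function.update (Function.update S b [x]) e [c]) rfl
        (fun z => by
          have h := sum_update_update (List.count z) S hbe [x] [c]
          simp only [hb, he, hcount, List.count_cons, List.count_nil] at h
          omega)
        b e f x c hbe (by simp [hbe]) (by simp) (by simp [hef.symm, hbf.symm, hf])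
        (fun a h₁ h₂ => by simpa [h₁, h₂] using hinit a)
      exact ⟨T, hT, .head hmove hreach⟩
    refine ⟨full, ?_⟩
    intro S hn hcount b d e x y hbd hb hd he hfull
    have hbe : b ≠ e := by rintro rfl; simp [hb] at he
    have hde : d ≠ e := by rintro rfl; simp [hd] at he
    by_cases hxy : x = y
    · subst hxy
      have hmove := waterMove_update (l := []) hbd hb hd (.inr rfl) (by simp)
      have hmix := sum_update_update mixedUnits S hbd [] [x, x]
      simp only [hb, hd, mixedUnits_nil, mixedUnits_singleton, mixedUnits_pair,
        if_true, hn] at hmix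
      obtain ⟨T, hT, hreach⟩ := full (Function.update (Function.update S b []) d [x, x])
        (by omega)
        (fun a => by
          by_cases h₂ : a = d
          · simp [h₂]
          by_cases h₁ : a = b
          · simp [h₁, hbd]
          simpa [h₁, h₂] using hfull a h₁ h₂)
        (fun z => by
          have h := sum_update_update (List.count z) S hbd [] [x, x]
          simp only [hb, hd, hcount, List.count_cons, List.count_nil] at h
          omega)
        ⟨b, e, hbe, by simp [hbd], by simp [hbe.symm, hde.symm, he]⟩
      exact ⟨T, hT, .head hmove hreach⟩
    obtain ⟨g, hgb, hg⟩ := exists_other_unit (hcount x) hb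
    have hgd : g ≠ d := by
      rintro rfl
      simp [hd, Ne.symm hxy] at hg
    have hge : g ≠ e := by
      rintro rfl
      simp [he] at hg
    obtain ⟨u, v, huv⟩ := List.length_eq_two.1
      ((hfull g hgb hgd).resolve_right fun h => by simp [List.length_eq_zero_iff.1 h] at hg)
    have huvne : u ≠ v := by
      rintro rfl
      by_cases h : u = x <;> simp [huv, h] at hg
    by_cases hvx : v = x
    · subst hvx
      have hmove := waterMove_update (l := [u]) hgb huv hb (.inr rfl) (by simpa using huvne)
      have hmix := sum_update_update mixedUnits S hgb [u] [v, v]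
      simp only [hb, huv, mixedUnits_singleton, mixedUnits_pair,
        if_true, if_neg huvne, hn] at hmix
      obtain ⟨T, hT, hreach⟩ := (ih _ (by omega)).2
        (Function.update (Function.update S g [u]) b [v, v]) rfl
        (fun z => by
          have h := sum_update_update (List.count z) S hgb [u] [v, v]
          simp only [hb, huv, hcount, List.count_cons, List.count_nil] at h
          omega)
        g d e u y hgd (by simp [hgb]) (by simp [hgd.symm, hbd.symm, hd])
        (by simp [hge.symm, hbe.symm, he])
        (fun a h₁ h₂ => by
          by_cases h : a = b
          · simp [h]
          simpa [h, h₁] using hfull a h h₂)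
      exact ⟨T, hT, .head hmove hreach⟩
    · have hux : u = x := by
        by_contra h
        simp [huv, h, hvx] at hg
      subst hux
      have hmove := waterMove_update (l := [u]) hge huv he (.inl rfl) (by simpa using huvne)
      have hmix := sum_update_update mixedUnits S hge [u] [v]
      simp only [he, huv, mixedUnits_nil, mixedUnits_singleton, mixedUnits_pair,
        if_neg huvne, hn] at hmix
      have hcount' : ∀ z, ∑ a, (Function.update (Function.update S g [u]) e [v] a).count z = 2 :=
        fun z => by
          have h := sum_update_update (List.count z) S hge [u] [v]
          simp only [he, huv, hcount, List.count_cons, List.count_nil] at h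
          omega
      simp only [List.nil_append] at hmove
      set S' := Function.update (Function.update S g [u]) e [v] with hS'
      have hb' : S' b = [u] := by simp [hS', hbe, hgb.symm, hb]
      have hg' : S' g = [u] := by simp [hS', hge]
      have hmove' := waterMove_update (l := []) hgb.symm hb' hg' (.inr rfl) (by simp)
      have hmix' := sum_update_update mixedUnits S' hgb.symm [] [u, u]
      simp only [hb', hg', mixedUnits_nil, mixedUnits_singleton, mixedUnits_pair,
        if_true] at hmix'
      obtain ⟨T, hT, hreach⟩ := (ih _ (by omega)).2
        (Function.update (Function.update S' b []) g [u, u]) rfl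
        (fun z => by
          have h := sum_update_update (List.count z) S' hgb.symm [] [u, u]
          simp only [hb', hg', hcount', List.count_cons, List.count_nil] at h
          omega)
        e d b v y hde.symm (by simp [hS', hge.symm, hbe.symm])
        (by simp [hS', hgd.symm, hbd.symm, hde, hd]) (by simp [hgb.symm])
        (fun a h₁ h₂ => by
          by_cases h : a = g
          · simp [h]
          by_cases h' : a = b
          · simp [h', hgb.symm]
          simpa [hS', h, h', h₁] using hfull a h' h₂)
      exact ⟨T, hT, .head hmove (.head hmove' hreach)⟩

/-- with capacity 2, each color occurring exactly twice, and at least 2 empty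
bins, every initial configuration can reach a sorted configuration by water-moves. -/
theorem statement_13 {B C : Type*} [Fintype B] [Fintype C] [DecidableEq B] [DecidableEq C]
    (S : B → List C) (hInit : InitConfig 2 S)
    (htwice : ∀ c : C, ∑ b, (S b).count c = 2)
    (hempty : 2 ≤ (Finset.univ.filter (fun b : B => S b = [])).card) :
    ∃ T : B → List C, SortedConfig 2 T ∧ Relation.ReflTransGen (WaterMove 2) S T := by
  obtain ⟨e, he, f, hf, hef⟩ := Finset.one_lt_card.1 hempty
  exact (exists_sorted_of_sum_mixedUnits _).1 S rfl hInit htwice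
    ⟨e, f, hef, (Finset.mem_filter.1 he).2, (Finset.mem_filter.1 hf).2⟩
end

section
/- Lower bound on sorting length for h = 2: let S be any configuration of capacity-2 bins in which each color occurs exactly twice. Then every sequence of water-moves S ⇒ S₁ ⇒ ⋯ ⇒ S_ℓ with S_ℓ sorted satisfies ℓ ≥ p_S + q_S + r_S, regardless of the number of empty bins. -/
open scoped Classical

section WaterSort

variable {B C : Type*}

/-- Each bin of a directed cycle is followed by a different bin of the cycle, and following
successors from any bin reaches the whole cycle. -/
lemma IsCycleSet.exists_succ {S : B → List C} {A : Finset B} (hA : IsCycleSet S A) :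
    ∃ s : B → B, (∀ b ∈ A, s b ∈ A ∧ s b ≠ b ∧ (S b).length = 2 ∧ (S (s b)).length = 2 ∧
        (S b)[1]? = (S (s b))[0]?) ∧
      ∀ T : Finset B, T ⊆ A → T.Nonempty → (∀ b ∈ T, s b ∈ T) → T = A := by
  obtain ⟨l, hnd, rfl, hlen, hfull, hchain, hclose⟩ := hA
  have hpos : 0 < l.length := by omega
  have hmod (i : ℕ) : i % l.length < l.length := Nat.mod_lt _ hpos
  have hnext : ∀ i (hi : i < l.length),
      (S l[i])[1]? = (S (l[(i + 1) % l.length]'(hmod _)))[0]? := by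
    intro i hi
    by_cases h : i + 1 < l.length
    · simp only [Nat.mod_eq_of_lt h]
      exact List.isChain_iff_getElem.1 hchain i h
    · have h1 : i = l.length - 1 := by omega
      have h2 : (i + 1) % l.length = 0 := by
        rw [show i + 1 = l.length by omega, Nat.mod_self]
      simp only [h2]
      refine hclose _ ?_ _ ?_
      · subst h1; simp [List.getLast?_eq_getElem?]
      · simp [List.head?_eq_getElem?]
  have hidx : ∀ i (hi : i < l.length), l.idxOf l[i] = i := fun i hi => hnd.idxOf_getElem i hi
  refine ⟨fun b => l[(l.idxOf b + 1) % l.length]'(hmod _), ?_, ?_⟩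
  · intro b hb
    rw [List.mem_toFinset] at hb
    obtain ⟨i, hi, rfl⟩ := List.getElem_of_mem hb
    simp only [hidx]
    refine ⟨by simp, ?_, hfull _ hb, hfull _ (List.getElem_mem _), hnext i hi⟩
    intro h
    have h' := (hnd.getElem_inj_iff).1 h
    by_cases h1 : i + 1 < l.length
    · rw [Nat.mod_eq_of_lt h1] at h'; omega
    · rw [show i + 1 = l.length by omega, Nat.mod_self] at h'; omega
  · rintro T hT ⟨b, hb⟩ hs
    refine hT.antisymm fun b' hb' => ?_
    obtain ⟨i, hi, rfl⟩ := List.getElem_of_mem (List.mem_toFinset.1 (hT hb))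
    obtain ⟨j, hj, rfl⟩ := List.getElem_of_mem (List.mem_toFinset.1 hb')
    have hreach : ∀ k, l[(i + k) % l.length]'(hmod _) ∈ T := by
      intro k
      induction k with
      | zero => simpa [Nat.mod_eq_of_lt hi] using hb
      | succ k ih =>
        have := hs _ ih
        simpa [hidx, add_assoc] using this
    have := hreach (l.length - i + j)
    have h2 : (i + (l.length - i + j)) % l.length = j := by
      rw [show i + (l.length - i + j) = j + l.length by omega, Nat.add_mod_right,
        Nat.mod_eq_of_lt hj]
    simpa only [h2] using this

lemma IsCycleSet.of_eqOn {S S' : B → List C} {A : Finset B} (hA : IsCycleSet S A)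
    (h : ∀ b ∈ A, S' b = S b) : IsCycleSet S' A := by
  obtain ⟨l, hnd, rfl, hlen, hfull, hchain, hclose⟩ := hA
  simp only [List.mem_toFinset] at h
  refine ⟨l, hnd, rfl, hlen, fun b hb => by rw [h b hb]; exact hfull b hb, ?_, ?_⟩
  · rw [List.Chain', List.isChain_iff_getElem] at *
    intro i hi
    rw [h _ (List.getElem_mem _), h _ (List.getElem_mem _)]
    exact hchain i hi
  · intro bl hbl bh hbh
    rw [h _ (List.mem_of_mem_getLast? hbl), h _ (List.mem_of_mem_head? hbh)]
    exact hclose bl hbl bh hbh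

lemma one_le_count_of_getElem? [DecidableEq C] {l : List C} {i : ℕ} {c : C}
    (h : l[i]? = some c) : 1 ≤ l.count c :=
  List.count_pos_iff.2 (List.mem_of_getElem? h)

lemma getElem?_one_of_eq_append_replicate {l l' : List C} {c : C} {m : ℕ} (hm : 1 ≤ m)
    (hl : l.length = 2) (h : l = l' ++ List.replicate m c) : l[1]? = some c := by
  have hlen : l'.length + m = 2 := by rw [← hl, h]; simp
  rw [h, List.getElem?_append_right (by omega), List.getElem?_replicate, if_pos (by omega)]

lemma WaterMove.config {h : ℕ} {S S' : B → List C} (hmove : WaterMove h S S')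
    (hS : Config h S) : Config h S' := by
  obtain ⟨b₁, b₂, c, m, -, -, h₁, -, -, hcap, -, hrest⟩ := hmove
  intro b
  by_cases hb₁ : b = b₁
  · have := hS b₁
    rw [h₁, List.length_append] at this
    subst hb₁; omega
  by_cases hb₂ : b = b₂
  · exact hb₂ ▸ hcap
  · exact hrest b hb₁ hb₂ ▸ hS b

variable [Fintype B]

lemma exists_of_indeg_eq_two {S : B → List C} {c : C} (h : indeg S c = 2) :
    ∃ x y, x ≠ y ∧ ((S x).length = 2 ∧ (S x)[1]? = some c) ∧
      ((S y).length = 2 ∧ (S y)[1]? = some c) := by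
  obtain ⟨x, y, hxy, hset⟩ := Finset.card_eq_two.1 h
  have hx : x ∈ ({x, y} : Finset B) := by simp
  have hy : y ∈ ({x, y} : Finset B) := by simp
  rw [← hset, Finset.mem_filter] at hx hy
  exact ⟨x, y, hxy, hx.2, hy.2⟩

variable [DecidableEq C]

lemma count_add_count_le {S : B → List C} {c : C} (h : ∑ b, (S b).count c = 2) {b₁ b₂ : B}
    (h₁₂ : b₁ ≠ b₂) : (S b₁).count c + (S b₂).count c ≤ 2 := by
  rw [← h, ← Finset.sum_pair h₁₂ (f := fun b => (S b).count c)]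
  exact Finset.sum_le_sum_of_subset (Finset.subset_univ _)

lemma count_add_count_add_count_le {S : B → List C} {c : C} (h : ∑ b, (S b).count c = 2)
    {b₁ b₂ b₃ : B} (h₁₂ : b₁ ≠ b₂) (h₁₃ : b₁ ≠ b₃) (h₂₃ : b₂ ≠ b₃) :
    (S b₁).count c + ((S b₂).count c + (S b₃).count c) ≤ 2 := by
  rw [← h, ← Finset.sum_pair h₂₃ (f := fun b => (S b).count c),
    ← Finset.sum_insert (f := fun b => (S b).count c) (by simp [h₁₂, h₁₃])]
  exact Finset.sum_le_sum_of_subset (Finset.subset_univ _)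

/-- When each color occurs twice, directed cycles sharing a bin coincide. -/
lemma IsCycleSet.eq_of_mem {S : B → List C} (htwice : ∀ c : C, ∑ b, (S b).count c = 2)
    {A A' : Finset B} (hA : IsCycleSet S A) (hA' : IsCycleSet S A') {b : B}
    (hb : b ∈ A) (hb' : b ∈ A') : A = A' := by
  obtain ⟨s, hs, hmin⟩ := hA.exists_succ
  obtain ⟨s', hs', hmin'⟩ := hA'.exists_succ
  have hss : ∀ b ∈ A ∩ A', s b = s' b := by
    intro b hb
    rw [Finset.mem_inter] at hb
    obtain ⟨-, h1, h2, -, h4⟩ := hs b hb.1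
    obtain ⟨-, h1', -, -, h4'⟩ := hs' b hb.2
    by_contra hne
    obtain ⟨x, y, hxy⟩ := List.length_eq_two.1 h2
    have hy : (S b)[1]? = some y := by simp [hxy]
    have := count_add_count_add_count_le (htwice y) h1.symm h1'.symm hne
    have := one_le_count_of_getElem? hy
    have := one_le_count_of_getElem? (h4.symm.trans hy)
    have := one_le_count_of_getElem? (h4'.symm.trans hy)
    omega
  have hne : (A ∩ A').Nonempty := ⟨b, Finset.mem_inter.2 ⟨hb, hb'⟩⟩
  rw [← hmin (A ∩ A') Finset.inter_subset_left hne fun b hb => Finset.mem_inter.2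
    ⟨(hs b (Finset.mem_inter.1 hb).1).1, hss b hb ▸ (hs' b (Finset.mem_inter.1 hb).2).1⟩]
  exact hmin' (A ∩ A') Finset.inter_subset_right hne fun b hb => Finset.mem_inter.2
    ⟨(hss b hb).symm ▸ (hs b (Finset.mem_inter.1 hb).1).1, (hs' b (Finset.mem_inter.1 hb).2).1⟩

lemma WaterMove.sum_count {h : ℕ} {S S' : B → List C} (hmove : WaterMove h S S') (d : C) :
    ∑ b, (S' b).count d = ∑ b, (S b).count d := by
  obtain ⟨b₁, b₂, c, m, -, hne, h₁, -, h₂, -, -, hrest⟩ := hmove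
  have key : ∑ b, ((S' b).count d + if b = b₁ then (List.replicate m c).count d else 0) =
      ∑ b, ((S b).count d + if b = b₂ then (List.replicate m c).count d else 0) := by
    refine Finset.sum_congr rfl fun b _ => ?_
    by_cases hb₁ : b = b₁
    · subst hb₁; simp [h₁, hne]
    by_cases hb₂ : b = b₂
    · subst hb₂; simp [h₂, hb₁]
    · simp [hb₁, hb₂, hrest b hb₁ hb₂]
  simpa [Finset.sum_add_distrib] using key

variable [Fintype C] [DecidableEq B]

/-- A single water-move decreases `p + q + r` by at most one. -/
lemma WaterMove.potential_le {S S' : B → List C} (hmove : WaterMove 2 S S')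
    (hconf : Config 2 S) (htwice : ∀ c : C, ∑ b, (S b).count c = 2) :
    pS S + qS S + rS S ≤ pS S' + qS S' + rS S' + 1 := by
  obtain ⟨b₁, b₂, c, m, hm, hne, h₁, -, h₂, hcap, -, hrest⟩ := hmove
  have hlen₁ : (S' b₁).length + m ≤ 2 := by simpa [h₁] using hconf b₁
  have hlen₂ : (S b₂).length + m ≤ 2 := by simpa [h₂] using hcap
  have hkeep : ∀ A, IsCycleSet S A → b₁ ∉ A → IsCycleSet S' A := by
    intro A hA hb
    obtain ⟨s, hs, -⟩ := hA.exists_succ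
    refine hA.of_eqOn fun b hbA => hrest b (fun h => hb (h ▸ hbA)) fun h => ?_
    have := (hs b hbA).2.2.1
    subst h; omega
  have hcycle : ∀ A, IsCycleSet S A → b₁ ∈ A → ∃ b ≠ b₁, (S b).length = 2 ∧
      (S b)[0]? = some c ∧ (S b₁)[1]? = some c := by
    intro A hA hb
    obtain ⟨s, hs, -⟩ := hA.exists_succ
    obtain ⟨-, hne', hfull, hfull', htop⟩ := hs b₁ hb
    have := getElem?_one_of_eq_append_replicate hm hfull h₁
    exact ⟨s b₁, hne', hfull', htop ▸ this, this⟩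
  have hindeg : ∀ d, d ≠ c → indeg S d = indeg S' d := by
    intro d hd
    unfold indeg
    congr 1
    ext b
    simp only [Finset.mem_filter, Finset.mem_univ, true_and]
    by_cases hb₁ : b = b₁
    · subst hb₁
      refine ⟨fun h => ?_, fun h => by omega⟩
      have := getElem?_one_of_eq_append_replicate hm h.1 h₁
      exact absurd (Option.some.inj (h.2.symm.trans this)) hd
    by_cases hb₂ : b = b₂
    · subst hb₂
      refine ⟨fun h => by omega, fun h => ?_⟩
      have := getElem?_one_of_eq_append_replicate hm h.1 h₂
      exact absurd (Option.some.inj (h.2.symm.trans this)) hd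
    · rw [hrest b hb₁ hb₂]
  have hsort : ∀ d, d ≠ c → ∀ b, (S' b).count d = (S b).count d := by
    intro d hd b
    have h0 : (List.replicate m c).count d = 0 := by
      simp [List.count_replicate, Ne.symm hd]
    by_cases hb₁ : b = b₁
    · subst hb₁; simp [h₁, h0]
    by_cases hb₂ : b = b₂
    · subst hb₂; simp [h₂, h0]
    · rw [hrest b hb₁ hb₂]
  have hhalf : (¬ ∃ b, (S b).count c = 2) → (∃ b, (S' b).count c = 2) →
      1 ≤ (S b₂).count c := by
    rintro hunsorted ⟨b, hb⟩
    by_cases hb₁ : b = b₁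
    · subst hb₁
      have := List.count_le_length (a := c) (l := S' b)
      omega
    by_cases hb₂ : b = b₂
    · subst hb₂
      rw [h₂, List.count_append, List.count_replicate_self] at hb
      by_contra h0
      refine hunsorted ⟨b₁, ?_⟩
      have h2 := count_add_count_le (htwice c) hne
      rw [h₁, List.count_append, List.count_replicate_self] at h2 ⊢
      omega
    · exact absurd ⟨b, hrest b hb₁ hb₂ ▸ hb⟩ hunsorted
  have hP : (∀ A, IsCycleSet S A → b₁ ∉ A) → pS S ≤ pS S' := fun h =>
    Finset.card_le_card fun A hA => by
      simp only [Finset.mem_filter, Finset.mem_univ, true_and] at hA ⊢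
      exact hkeep A hA (h A hA)
  have hP1 : pS S ≤ pS S' + 1 := by
    by_cases h : ∀ A, IsCycleSet S A → b₁ ∉ A
    · exact (hP h).trans (Nat.le_succ _)
    · push Not at h
      obtain ⟨A₀, hA₀, hb₀⟩ := h
      refine (Finset.card_le_card (fun A hA => ?_)).trans (Finset.card_insert_le A₀ _)
      simp only [Finset.mem_insert, Finset.mem_filter, Finset.mem_univ, true_and] at hA ⊢
      by_cases hb : b₁ ∈ A
      · exact Or.inl (hA.eq_of_mem htwice hA₀ hb hb₀)
      · exact Or.inr (hkeep A hA hb)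
  have hQ : indeg S c ≠ 2 → qS S ≤ qS S' := fun h =>
    Finset.card_le_card fun d hd => by
      simp only [Finset.mem_filter, Finset.mem_univ, true_and] at hd ⊢
      rw [← hindeg d (by rintro rfl; exact h hd)]
      exact hd
  have hQ1 : qS S ≤ qS S' + 1 := by
    refine (Finset.card_le_card (fun d hd => ?_)).trans (Finset.card_insert_le c _)
    simp only [Finset.mem_insert, Finset.mem_filter, Finset.mem_univ, true_and] at hd ⊢
    by_cases hdc : d = c
    · exact Or.inl hdc
    · exact Or.inr (hindeg d hdc ▸ hd)
  have hR : ((¬ ∃ b, (S b).count c = 2) → ¬ ∃ b, (S' b).count c = 2) → rS S ≤ rS S' :=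
    fun h => Finset.card_le_card fun d hd => by
      simp only [Finset.mem_filter, Finset.mem_univ, true_and] at hd ⊢
      by_cases hdc : d = c
      · subst hdc; exact h hd
      · simpa only [hsort d hdc] using hd
  have hR1 : rS S ≤ rS S' + 1 := by
    refine (Finset.card_le_card (fun d hd => ?_)).trans (Finset.card_insert_le c _)
    simp only [Finset.mem_insert, Finset.mem_filter, Finset.mem_univ, true_and] at hd ⊢
    by_cases hdc : d = c
    · exact Or.inl hdc
    · right; simpa only [hsort d hdc] using hd
  have hfull_ne : ∀ b, (S b).length = 2 → b ≠ b₂ := by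
    rintro b hb rfl; omega
  by_cases hr : (¬ ∃ b, (S b).count c = 2) ∧ ∃ b, (S' b).count c = 2
  · have hc₂ := hhalf hr.1 hr.2
    have hp : ∀ A, IsCycleSet S A → b₁ ∉ A := by
      intro A hA hb
      obtain ⟨b, hbne, hfull, hbot, htop⟩ := hcycle A hA hb
      have := count_add_count_add_count_le (htwice c) hbne (hfull_ne b hfull) hne
      have := one_le_count_of_getElem? hbot
      have := one_le_count_of_getElem? htop
      omega
    have hq : indeg S c ≠ 2 := by
      intro h
      obtain ⟨x, y, hxy, hx, hy⟩ := exists_of_indeg_eq_two h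
      have := count_add_count_add_count_le (htwice c) hxy (hfull_ne x hx.1) (hfull_ne y hy.1)
      have := one_le_count_of_getElem? hx.2
      have := one_le_count_of_getElem? hy.2
      omega
    have := hP hp
    have := hQ hq
    omega
  · have := hR (by tauto)
    by_cases hq : indeg S c = 2
    · have hp : ∀ A, IsCycleSet S A → b₁ ∉ A := by
        intro A hA hb
        obtain ⟨b, hbne, hfull, hbot, htop⟩ := hcycle A hA hb
        obtain ⟨x, y, hxy, hx, hy⟩ := exists_of_indeg_eq_two hq
        obtain ⟨u, v, huv⟩ := List.length_eq_two.1 hfull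
        have hcb := one_le_count_of_getElem? hbot
        have hcx := one_le_count_of_getElem? hx.2
        have hcy := one_le_count_of_getElem? hy.2
        have hcb₁ := one_le_count_of_getElem? htop
        have htwo : (S b)[1]? = some c → (S b).count c = 2 := by
          intro h
          simp_all
        by_cases hbx : b = x
        · have := htwo (hbx ▸ hx.2)
          have := count_add_count_le (htwice c) hbne
          omega
        by_cases hby : b = y
        · have := htwo (hby ▸ hy.2)
          have := count_add_count_le (htwice c) hbne
          omega
        have := count_add_count_add_count_le (htwice c) hbx hby hxy
        omega
      have := hP hp
      omega
    · have := hQ hq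
      omega

lemma SortedConfig.potential_eq_zero {S : B → List C} (hS : SortedConfig 2 S)
    (htwice : ∀ c : C, ∑ b, (S b).count c = 2) : pS S + qS S + rS S = 0 := by
  have hcount : ∀ b c (i : ℕ), (S b)[i]? = some c → (S b).count c = 2 := by
    intro b c i h
    rcases hS b with h0 | ⟨d, hd⟩
    · simp [h0] at h
    · have := List.mem_of_getElem? h
      rw [hd, List.mem_replicate] at this
      simp [hd, this.2]
  have huniq : ∀ b b' c (i j : ℕ), (S b)[i]? = some c → (S b')[j]? = some c → b = b' := by
    intro b b' c i j h h'
    by_contra hne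
    have := count_add_count_le (htwice c) hne
    have := hcount _ _ _ h
    have := hcount _ _ _ h'
    omega
  have hp : pS S = 0 := by
    refine Finset.card_eq_zero.2 (Finset.filter_eq_empty_iff.2 fun A _ hA => ?_)
    obtain ⟨l, -, rfl, hlen, -⟩ := id hA
    obtain ⟨s, hs, -⟩ := hA.exists_succ
    obtain ⟨-, hne, hfull, -, htop⟩ := hs l[0] (by simp)
    obtain ⟨x, y, hxy⟩ := List.length_eq_two.1 hfull
    have hy : (S l[0])[1]? = some y := by simp [hxy]
    exact hne (huniq _ _ _ _ _ (htop.symm.trans hy) hy)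
  have hq : qS S = 0 := by
    refine Finset.card_eq_zero.2 (Finset.filter_eq_empty_iff.2 fun c _ hc => ?_)
    obtain ⟨x, y, hxy, hx, hy⟩ := exists_of_indeg_eq_two hc
    exact hxy (huniq _ _ _ _ _ hx.2 hy.2)
  have hr : rS S = 0 := by
    refine Finset.card_eq_zero.2 (Finset.filter_eq_empty_iff.2 fun c _ => not_not.2 ?_)
    have hpos : ∑ b, (S b).count c ≠ 0 := by rw [htwice]; decide
    obtain ⟨b, -, hb⟩ := Finset.exists_ne_zero_of_sum_ne_zero hpos
    obtain ⟨i, hi⟩ := List.mem_iff_getElem?.1 (List.count_pos_iff.1 (Nat.pos_of_ne_zero hb))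
    exact ⟨b, hcount _ _ _ hi⟩
  omega

end WaterSort

/-- with capacity 2 and each color occurring exactly twice, every sorting
sequence of water-moves has length at least `p_S + q_S + r_S`, regardless of the number of
empty bins. -/
theorem statement_15 {B C : Type*} [Fintype B] [Fintype C] [DecidableEq B] [DecidableEq C]
    (S : B → List C) (hconf : Config 2 S)
    (htwice : ∀ c : C, ∑ b, (S b).count c = 2)
    (ℓ : ℕ) (f : ℕ → B → List C) (hf0 : f 0 = S)
    (hstep : ∀ i < ℓ, WaterMove 2 (f i) (f (i + 1))) (hsorted : SortedConfig 2 (f ℓ)) :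
    pS S + qS S + rS S ≤ ℓ := by
  induction ℓ generalizing S f with
  | zero => exact (SortedConfig.potential_eq_zero (hf0 ▸ hsorted) htwice).le
  | succ n ih =>
    have hmove : WaterMove 2 S (f 1) := hf0 ▸ hstep 0 n.succ_pos
    have hrest := ih (f 1) (hmove.config hconf) (fun c => (hmove.sum_count c).trans (htwice c))
      (fun i => f (i + 1)) rfl (fun i hi => hstep (i + 1) (Nat.succ_lt_succ hi)) hsorted
    have := hmove.potential_le hconf htwice
    omega
end

section
/- Sufficiently many empty bins guarantee solvability: let S₀ be an initial configuration with n full bins of capacity h in which the total number of occurrences of each color is divisible by h, together with at least ⌈(h − 1)·n / h⌉ empty bins. Then S₀ can reach a sorted configuration by water-moves. -/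
open scoped Classical

/-- All entries of the list are equal. -/
def Monochromatic {C : Type*} (l : List C) : Prop := ∀ x ∈ l, ∀ y ∈ l, x = y

theorem Monochromatic.of_append_left {C : Type*} {l l' : List C}
    (hl : Monochromatic (l ++ l')) : Monochromatic l :=
  fun x hx y hy => hl x (by simp [hx]) y (by simp [hy])

theorem Monochromatic.eq_of_mem {C : Type*} {l : List C} {c : C} (hl : Monochromatic l)
    (hc : c ∈ l) : l = List.replicate l.length c :=
  List.eq_replicate_iff.2 ⟨rfl, fun x hx => hl x hx c hc⟩

theorem Monochromatic.append_replicate {C : Type*} {l : List C} {c : C} (hl : Monochromatic l)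
    (hc : l = [] ∨ l.getLast? = some c) (m : ℕ) :
    Monochromatic (l ++ List.replicate m c) := by
  have key : ∀ x ∈ l ++ List.replicate m c, x = c := by
    intro x hx
    rcases List.mem_append.1 hx with hx | hx
    · rcases hc with rfl | hc
      · simp at hx
      · exact hl x hx c (List.mem_of_getLast? hc)
    · exact List.eq_of_mem_replicate hx
  exact fun x hx y hy => (key x hx).trans (key y hy).symm

theorem two_le_length_of_not_monochromatic {C : Type*} {l : List C} (hl : ¬ Monochromatic l) :
    2 ≤ l.length := by
  by_contra hlt
  apply hl
  match l, hlt with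
  | [], _ => simp [Monochromatic]
  | [a], _ => simp [Monochromatic]
  | _ :: _ :: _, hlt => simp at hlt

theorem exists_getLast?_eq_some {C : Type*} {l : List C} (hl : l ≠ []) :
    ∃ c, l.getLast? = some c :=
  ⟨l.getLast hl, List.getLast?_eq_some_getLast hl⟩

/-- A list splits into a rest and its maximal run of the top color. -/
theorem exists_maximal_run {C : Type*} (l : List C) (c : C) :
    ∃ l' r, l = l' ++ List.replicate r c ∧ l'.getLast? ≠ some c := by
  induction l using List.reverseRecOn with
  | nil => exact ⟨[], 0, by simp⟩
  | append_singleton l x ih =>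
    by_cases hx : x = c
    · obtain ⟨l', r, rfl, hl'⟩ := ih
      exact ⟨l', r + 1, by simp [hx, List.replicate_succ'], hl'⟩
    · exact ⟨l ++ [x], 0, by simp, by simp [hx]⟩

/-- Pouring from a bin with top color `c` into a nonfull bin that is empty or has top color `c`. -/
theorem exists_pour {B C : Type*} {h : ℕ} {S : B → List C} {a b : B} {c : C} (hab : a ≠ b)
    (ha : (S a).getLast? = some c) (hb : S b = [] ∨ (S b).getLast? = some c)
    (hlen : (S b).length < h) :
    ∃ S' m, WaterMove h S S' ∧ 1 ≤ m ∧ S a = S' a ++ List.replicate m c ∧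
      S' b = S b ++ List.replicate m c ∧ (S' b).length ≤ h ∧
      ((S' a).getLast? ≠ some c ∨ (S' b).length = h) ∧
      ∀ x, x ≠ a → x ≠ b → S' x = S x := by
  obtain ⟨l', r, hl, hl'⟩ := exists_maximal_run (S a) c
  have hr : 1 ≤ r := by
    by_contra hr
    obtain rfl : r = 0 := by omega
    simp only [List.replicate_zero, List.append_nil] at hl
    exact hl' (hl ▸ ha)
  let m := min r (h - (S b).length)
  have hm : 1 ≤ m := by simp only [m]; omega
  let S' := Function.update (Function.update S a (l' ++ List.replicate (r - m) c)) b
    (S b ++ List.replicate m c)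
  have hSa : S' a = l' ++ List.replicate (r - m) c := by simp [S', hab]
  have hSb : S' b = S b ++ List.replicate m c := by simp [S']
  have hsplit : S a = S' a ++ List.replicate m c := by
    rw [hSa, List.append_assoc, ← List.replicate_add, hl]
    congr 2
    simp only [m]; omega
  have hle : (S' b).length ≤ h := by
    simp only [hSb, List.length_append, List.length_replicate, m]; omega
  have hmax : (S' a).getLast? ≠ some c ∨ (S' b).length = h := by
    by_cases hrm : r ≤ h - (S b).length
    · left
      have : r - m = 0 := by simp only [m]; omega
      simpa [hSa, this] using hl'
    · right
      simp only [hSb, List.length_append, List.length_replicate, m]; omega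
  have hrest : ∀ x, x ≠ a → x ≠ b → S' x = S x := fun x hxa hxb => by simp [S', hxa, hxb]
  exact ⟨S', m, ⟨a, b, c, m, hm, hab, hsplit, hb, hSb, hle, hmax, hrest⟩, hm, hsplit, hSb, hle,
    hmax, hrest⟩

theorem sum_add_of_eq_off_pair {B X : Type*} [Fintype B] (f : X → ℕ) {S S' : B → X} {a b : B}
    (hab : a ≠ b) (hrest : ∀ x, x ≠ a → x ≠ b → S' x = S x) :
    ∑ x, f (S x) + (f (S' a) + f (S' b)) = ∑ x, f (S' x) + (f (S a) + f (S b)) := by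
  have split : ∀ g : B → ℕ, ∑ x, g x = g a + (g b + ∑ x ∈ (Finset.univ.erase a).erase b, g x) := by
    intro g
    rw [Finset.add_sum_erase _ _ (by simp [hab.symm]), Finset.add_sum_erase _ _ (by simp)]
  have hcongr : ∑ x ∈ (Finset.univ.erase a).erase b, f (S' x) =
      ∑ x ∈ (Finset.univ.erase a).erase b, f (S x) := by
    refine Finset.sum_congr rfl fun x hx => ?_
    simp only [Finset.mem_erase] at hx
    rw [hrest x hx.2.1 hx.1]
  rw [split fun x => f (S x), split fun x => f (S' x), hcongr]
  omega

/-- A sum of positive terms of which at most one is below `h` exceeds `h * (s.card - 1)`. -/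
theorem mul_card_lt_sum_add {B : Type*} {h : ℕ} (hh : 1 ≤ h) (s : Finset B) (g : B → ℕ)
    (hpos : ∀ b ∈ s, 1 ≤ g b)
    (huniq : ∀ b ∈ s, ∀ b' ∈ s, g b < h → g b' < h → b = b') :
    h * s.card < ∑ b ∈ s, g b + h := by
  by_cases hall : ∀ b ∈ s, h ≤ g b
  · have : s.card • h ≤ ∑ b ∈ s, g b := Finset.card_nsmul_le_sum s g h hall
    rw [smul_eq_mul, mul_comm] at this
    omega
  · push Not at hall
    obtain ⟨b₀, hb₀, hlt⟩ := hall
    have h1 : (s.erase b₀).card • h ≤ ∑ b ∈ s.erase b₀, g b := by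
      refine Finset.card_nsmul_le_sum (s.erase b₀) g h fun b hb => ?_
      by_contra hb'
      exact (Finset.mem_erase.1 hb).1
        (huniq b (Finset.mem_of_mem_erase hb) b₀ hb₀ (by omega) hlt)
    rw [smul_eq_mul, mul_comm] at h1
    rw [← Finset.add_sum_erase s g hb₀, ← Finset.card_erase_add_one hb₀, mul_add]
    have := hpos b₀ hb₀
    omega

/-- The states visited by the strategy: at most one non-monochromatic bin is partially filled. -/
structure Admissible {B C : Type*} [Fintype B] [DecidableEq C] (h n : ℕ) (S : B → List C) :
    Prop where
  length_le : ∀ b, (S b).length ≤ h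
  dvd_count : ∀ c, h ∣ ∑ b, (S b).count c
  sum_length : ∑ b, (S b).length = h * n
  unique_partial : ∀ b b', ¬ Monochromatic (S b) → ¬ Monochromatic (S b') →
    (S b).length < h → (S b').length < h → b = b'

/-- Two distinct partially filled monochromatic bins share their color. -/
def Mergeable {B C : Type*} (h : ℕ) (S : B → List C) : Prop :=
  ∃ a b c, a ≠ b ∧ Monochromatic (S a) ∧ Monochromatic (S b) ∧ (S a).getLast? = some c ∧
    (S b).getLast? = some c ∧ (S a).length < h ∧ (S b).length < h

theorem sum_count_eq_sum_length {B C : Type*} [Fintype B] [Fintype C] [DecidableEq C]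
    (S : B → List C) : ∑ c, ∑ b, (S b).count c = ∑ b, (S b).length := by
  rw [Finset.sum_comm]
  refine Finset.sum_congr rfl fun b _ => ?_
  have := Multiset.sum_count_eq_card (s := Finset.univ) (m := (S b : Multiset C)) (by simp)
  simpa using this

/-- With enough bins, any non-monochromatic bin can be poured unless two bins can be merged. -/
theorem exists_target {B C : Type*} [Fintype B] [Fintype C] [DecidableEq C] {h n k : ℕ}
    (hh : 1 ≤ h) {S : B → List C} (hS : Admissible h n S) (hcard : n + k ≤ Fintype.card B)
    (hk : (h - 1) * n ≤ h * k) (hmerge : ¬ Mergeable h S) {a : B} {t : C}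
    (ha : ¬ Monochromatic (S a)) (hat : (S a).getLast? = some t)
    (hactive : ∀ b, ¬ Monochromatic (S b) → b ≠ a → (S b).length = h) :
    ∃ b, a ≠ b ∧ Monochromatic (S b) ∧ (S b).length < h ∧
      (S b = [] ∨ (S b).getLast? = some t) := by
  by_contra hno
  push Not at hno
  have hne : ∀ b, S b ≠ [] := by
    intro b hb
    have hab : a ≠ b := by rintro rfl; simp [hb] at hat
    exact (hno b hab (by simp [hb, Monochromatic]) (by simp [hb]; omega)).1 hb
  let P : Finset B := Finset.univ.filter fun b => Monochromatic (S b) ∨ b = a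
  let Q : C → Finset B := fun c => P.filter fun b => (S b).getLast? = some c
  have hQ : ∀ c, h * (Q c).card ≤ ∑ b, (S b).count c := by
    intro c
    have hlt := mul_card_lt_sum_add hh (Q c) (fun b => (S b).count c)
      (fun b hb => List.count_pos_iff.2 (List.mem_of_getLast? (Finset.mem_filter.1 hb).2))
      (by
        have full : ∀ b, Monochromatic (S b) → (S b).getLast? = some c →
            (S b).count c = (S b).length := fun b hb hc => by
          rw [List.count_eq_length]
          exact fun x hx => hb c (List.mem_of_getLast? hc) x hx
        intro b hb b' hb' hlt hlt'
        simp only [Q, P, Finset.mem_filter, Finset.mem_univ, true_and] at hb hb'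
        by_contra hbb
        rcases hb with ⟨hb | rfl, hbc⟩ <;> rcases hb' with ⟨hb' | rfl, hbc'⟩
        · rw [full b hb hbc] at hlt
          rw [full b' hb' hbc'] at hlt'
          exact hmerge ⟨b, b', c, hbb, hb, hb', hbc, hbc', hlt, hlt'⟩
        · rw [full b hb hbc] at hlt
          exact (hno b (Ne.symm hbb) hb hlt).2 (hbc.trans (hbc'.symm.trans hat))
        · rw [full b' hb' hbc'] at hlt'
          exact (hno b' hbb hb' hlt').2 (hbc'.trans (hbc.symm.trans hat))
        · exact hbb rfl)
    have hle : ∑ b ∈ Q c, (S b).count c ≤ ∑ b, (S b).count c :=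
      Finset.sum_le_sum_of_subset (Finset.subset_univ _)
    obtain ⟨d, hd⟩ := hS.dvd_count c
    rw [hd] at hle ⊢
    have : h * (Q c).card < h * (d + 1) := by rw [mul_add]; omega
    have := Nat.lt_of_mul_lt_mul_left this
    exact Nat.mul_le_mul_left h (by omega)
  have hPQ : P.card ≤ ∑ c, (Q c).card := by
    refine le_trans (Finset.card_le_card fun b hb => ?_) Finset.card_biUnion_le
    obtain ⟨c, hc⟩ := exists_getLast?_eq_some (hne b)
    simp only [Finset.mem_biUnion, Finset.mem_univ, true_and]
    exact ⟨c, Finset.mem_filter.2 ⟨hb, hc⟩⟩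
  have hPn : P.card ≤ n := by
    refine Nat.le_of_mul_le_mul_left (?_ : h * P.card ≤ h * n) hh
    calc h * P.card ≤ ∑ c, h * (Q c).card := by
          rw [← Finset.mul_sum]; exact Nat.mul_le_mul_left h hPQ
      _ ≤ ∑ c, ∑ b, (S b).count c := Finset.sum_le_sum fun c _ => hQ c
      _ = h * n := by rw [sum_count_eq_sum_length, hS.sum_length]
  have haP : a ∈ P := by simp [P]
  have hsumP : P.card + 1 ≤ ∑ b ∈ P, (S b).length := by
    rw [← Finset.add_sum_erase P _ haP, ← Finset.card_erase_add_one haP]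
    have h1 := Finset.card_nsmul_le_sum (P.erase a) (fun b => (S b).length) 1
      fun b _ => List.length_pos_iff.2 (hne b)
    have h2 := two_le_length_of_not_monochromatic ha
    simp only [smul_eq_mul, mul_one] at h1
    omega
  have hsumPc : Pᶜ.card * h ≤ ∑ b ∈ Pᶜ, (S b).length := by
    refine Finset.card_nsmul_le_sum _ _ h fun b hb => ?_
    simp only [P, Finset.mem_compl, Finset.mem_filter, Finset.mem_univ, true_and, not_or] at hb
    exact (hactive b hb.1 hb.2).ge
  have hsum := Finset.sum_add_sum_compl P fun b => (S b).length
  rw [hS.sum_length] at hsum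
  have hc := Finset.card_add_card_compl P
  obtain ⟨g, rfl⟩ : ∃ g, h = g + 1 := ⟨h - 1, by omega⟩
  simp only [Nat.add_sub_cancel] at hk
  nlinarith

/-- The potential of a bin. -/
noncomputable def binPotential {C : Type*} (h : ℕ) (l : List C) : ℕ :=
  if Monochromatic l then (if l = [] ∨ l.length = h then 0 else 1) else 3 * l.length

theorem binPotential_le_one {C : Type*} {h : ℕ} {l : List C} (hl : Monochromatic l) :
    binPotential h l ≤ 1 := by
  rw [binPotential, if_pos hl]; split_ifs <;> omega

theorem Admissible.of_pour {B C : Type*} [Fintype B] [DecidableEq C] {h n m : ℕ}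
    {S S' : B → List C} (hS : Admissible h n S) {a b : B} {c : C} (hab : a ≠ b)
    (hb : Monochromatic (S b)) (hbc : S b = [] ∨ (S b).getLast? = some c)
    (hactive : ∀ x, ¬ Monochromatic (S a) → ¬ Monochromatic (S x) → x ≠ a → (S x).length = h)
    (hSa : S a = S' a ++ List.replicate m c) (hSb : S' b = S b ++ List.replicate m c)
    (hle : (S' b).length ≤ h) (hrest : ∀ x, x ≠ a → x ≠ b → S' x = S x) :
    Admissible h n S' := by
  have hb' : Monochromatic (S' b) := hSb ▸ hb.append_replicate hbc m
  have ha' : ¬ Monochromatic (S' a) → ¬ Monochromatic (S a) := fun h1 h2 =>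
    h1 ((hSa ▸ h2).of_append_left)
  refine ⟨fun x => ?_, fun d => ?_, ?_, fun x y hx hy hxl hyl => ?_⟩
  · by_cases hxb : x = b
    · exact hxb ▸ hle
    by_cases hxa : x = a
    · have := hS.length_le a
      rw [hSa, List.length_append] at this
      rw [hxa]; omega
    · rw [hrest x hxa hxb]; exact hS.length_le x
  · have := sum_add_of_eq_off_pair (fun l : List C => l.count d) hab hrest
    rw [hSb, hSa, List.count_append, List.count_append] at this
    have : ∑ x, (S' x).count d = ∑ x, (S x).count d := by omega
    exact this ▸ hS.dvd_count d
  · have := sum_add_of_eq_off_pair (fun l : List C => l.length) hab hrest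
    rw [hSb, hSa, List.length_append, List.length_append] at this
    rw [← hS.sum_length]; omega
  · have hxb : x ≠ b := by rintro rfl; exact hx hb'
    have hyb : y ≠ b := by rintro rfl; exact hy hb'
    by_cases hxa : x = a <;> by_cases hya : y = a
    · rw [hxa, hya]
    · subst hxa
      rw [hrest y hya hyb] at hy hyl
      have := hactive y (ha' hx) hy hya
      omega
    · subst hya
      rw [hrest x hxa hxb] at hx hxl
      have := hactive x (ha' hy) hx hxa
      omega
    · rw [hrest x hxa hxb] at hx hxl
      rw [hrest y hya hyb] at hy hyl
      exact hS.unique_partial x y hx hy hxl hyl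

theorem Mergeable.exists_move {B C : Type*} [Fintype B] [DecidableEq C] {h n : ℕ}
    {S : B → List C} (hS : Admissible h n S) (hmerge : Mergeable h S) :
    ∃ S', WaterMove h S S' ∧ Admissible h n S' ∧
      ∑ b, binPotential h (S' b) < ∑ b, binPotential h (S b) := by
  obtain ⟨a, b, c, hab, ha, hb, hac, hbc, hal, hbl⟩ := hmerge
  obtain ⟨S', m, hmove, hm, hSa, hSb, hle, hmax, hrest⟩ := exists_pour hab hac (Or.inr hbc) hbl
  refine ⟨S', hmove, hS.of_pour hab hb (Or.inr hbc) (fun x hx => absurd ha hx) hSa hSb hle hrest,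
    ?_⟩
  have hsum := sum_add_of_eq_off_pair (binPotential h) hab hrest
  have ha' : Monochromatic (S' a) := (hSa ▸ ha).of_append_left
  have hb' : Monochromatic (S' b) := hSb ▸ hb.append_replicate (Or.inr hbc) m
  have hpa : binPotential h (S a) = 1 := by
    have : S a ≠ [] := by rintro h0; simp [h0] at hac
    simp [binPotential, ha, this, hal.ne]
  have hpb : binPotential h (S b) = 1 := by
    have : S b ≠ [] := by rintro h0; simp [h0] at hbc
    simp [binPotential, hb, this, hbl.ne]
  have hpa' := binPotential_le_one (h := h) ha'
  have hpb' := binPotential_le_one (h := h) hb'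
  rcases hmax with hmax | hmax
  · have : S' a = [] := by
      by_contra h0
      obtain ⟨d, hd⟩ := exists_getLast?_eq_some h0
      refine hmax (hd.trans (congrArg some (ha d ?_ c (List.mem_of_getLast? hac))))
      rw [hSa]
      exact List.mem_append_left _ (List.mem_of_getLast? hd)
    have : binPotential h (S' a) = 0 := by simp [binPotential, this]
    omega
  · have : binPotential h (S' b) = 0 := by simp [binPotential, hb', hmax]
    omega

theorem Admissible.exists_move {B C : Type*} [Fintype B] [Fintype C] [DecidableEq C] {h n k : ℕ}
    (hh : 1 ≤ h) {S : B → List C} (hS : Admissible h n S) (hcard : n + k ≤ Fintype.card B)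
    (hk : (h - 1) * n ≤ h * k) (hmerge : ¬ Mergeable h S) (hmono : ∃ b, ¬ Monochromatic (S b)) :
    ∃ S', WaterMove h S S' ∧ Admissible h n S' ∧
      ∑ b, binPotential h (S' b) < ∑ b, binPotential h (S b) := by
  obtain ⟨a, ha, hactive⟩ : ∃ a, ¬ Monochromatic (S a) ∧
      ∀ b, ¬ Monochromatic (S b) → b ≠ a → (S b).length = h := by
    by_cases hpart : ∃ a, ¬ Monochromatic (S a) ∧ (S a).length < h
    · obtain ⟨a, ha, hal⟩ := hpart
      refine ⟨a, ha, fun b hb hba => ?_⟩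
      by_contra hbl
      exact hba (hS.unique_partial b a hb ha (lt_of_le_of_ne (hS.length_le b) hbl) hal)
    · obtain ⟨a, ha⟩ := hmono
      push Not at hpart
      exact ⟨a, ha, fun b hb _ => le_antisymm (hS.length_le b) (hpart b hb)⟩
  have hal := two_le_length_of_not_monochromatic ha
  obtain ⟨t, hat⟩ := exists_getLast?_eq_some (List.length_pos_iff.1 (by omega : 0 < (S a).length))
  obtain ⟨b, hab, hb, hbl, hbt⟩ := exists_target hh hS hcard hk hmerge ha hat hactive
  obtain ⟨S', m, hmove, hm, hSa, hSb, hle, -, hrest⟩ := exists_pour hab hat hbt hbl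
  refine ⟨S', hmove, hS.of_pour hab hb hbt (fun x _ => hactive x) hSa hSb hle hrest, ?_⟩
  have hsum := sum_add_of_eq_off_pair (binPotential h) hab hrest
  have hpb' := binPotential_le_one (h := h) (hSb ▸ hb.append_replicate hbt m)
  have hpa : binPotential h (S a) = 3 * (S a).length := by simp [binPotential, ha]
  have hlen : (S a).length = (S' a).length + m := by
    have := congrArg List.length hSa
    simpa using this
  have hpa' : binPotential h (S' a) ≤ 1 ∨ binPotential h (S' a) = 3 * (S' a).length := by
    by_cases ha' : Monochromatic (S' a)
    · exact Or.inl (binPotential_le_one ha')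
    · exact Or.inr (by simp [binPotential, ha'])
  omega

theorem Admissible.sortedConfig {B C : Type*} [Fintype B] [DecidableEq C] {h n : ℕ}
    {S : B → List C} (hS : Admissible h n S) (hmerge : ¬ Mergeable h S)
    (hmono : ∀ b, Monochromatic (S b)) : SortedConfig h S := by
  intro b
  by_cases hb : S b = []
  · exact Or.inl hb
  right
  obtain ⟨c, hc⟩ := exists_getLast?_eq_some hb
  have hrep := (hmono b).eq_of_mem (List.mem_of_getLast? hc)
  refine ⟨c, ?_⟩
  suffices hfull : (S b).length = h by rwa [hfull] at hrep
  by_contra hne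
  have hlt : (S b).length < h := lt_of_le_of_ne (hS.length_le b) hne
  have hothers : h ∣ ∑ x ∈ Finset.univ.erase b, (S x).count c := by
    refine Finset.dvd_sum fun x hx => ?_
    by_cases hcx : c ∈ S x
    · have hx' := (hmono x).eq_of_mem hcx
      have hxl : ¬ (S x).length < h := fun hxl => by
        refine hmerge ⟨x, b, c, Finset.ne_of_mem_erase hx, hmono x, hmono b, ?_, hc, hxl, hlt⟩
        obtain ⟨d, hd⟩ := exists_getLast?_eq_some (List.ne_nil_of_mem hcx)
        rw [hd, hmono x d (List.mem_of_getLast? hd) c hcx]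
      have hxh : (S x).length = h := le_antisymm (hS.length_le x) (not_lt.1 hxl)
      rw [hx', List.count_replicate_self, hxh]
    · rw [List.count_eq_zero_of_not_mem hcx]; exact dvd_zero h
  have htotal := hS.dvd_count c
  rw [← Finset.add_sum_erase _ _ (Finset.mem_univ b), Nat.dvd_add_left hothers, hrep,
    List.count_replicate_self] at htotal
  exact absurd (Nat.le_of_dvd (List.length_pos_iff.2 hb) htotal) (by omega)

theorem Admissible.exists_sorted {B C : Type*} [Fintype B] [Fintype C] [DecidableEq C] {h n k : ℕ}
    (hh : 1 ≤ h) (hcard : n + k ≤ Fintype.card B) (hk : (h - 1) * n ≤ h * k) {S : B → List C}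
    (hS : Admissible h n S) :
    ∃ T : B → List C, SortedConfig h T ∧ Relation.ReflTransGen (WaterMove h) S T := by
  induction hp : ∑ b, binPotential h (S b) using Nat.strong_induction_on generalizing S with
  | _ p ih =>
    have step : (∃ S', WaterMove h S S' ∧ Admissible h n S' ∧
        ∑ b, binPotential h (S' b) < ∑ b, binPotential h (S b)) →
        ∃ T : B → List C, SortedConfig h T ∧ Relation.ReflTransGen (WaterMove h) S T := by
      rintro ⟨S', hmove, hS', hlt⟩
      obtain ⟨T, hT, hreach⟩ := ih _ (hp ▸ hlt) hS' rfl
      exact ⟨T, hT, hreach.head hmove⟩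
    by_cases hmerge : Mergeable h S
    · exact step (hmerge.exists_move hS)
    by_cases hmono : ∃ b, ¬ Monochromatic (S b)
    · exact step (hS.exists_move hh hcard hk hmerge hmono)
    · push Not at hmono
      exact ⟨S, hS.sortedConfig hmerge hmono, .refl⟩

/-- an initial configuration with `n` full bins of capacity `h`, each color's
number of occurrences divisible by `h`, and at least `⌈(h−1)·n/h⌉` empty bins can always
reach a sorted configuration by water-moves. -/
theorem statement_18 {B C : Type*} [Fintype B] [Fintype C] [DecidableEq C]
    (h : ℕ) (hh : 1 ≤ h) (n : ℕ) (S₀ : B → List C) (hInit : InitConfig h S₀)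
    (hfull : (Finset.univ.filter (fun b : B => (S₀ b).length = h)).card = n)
    (hdiv : ∀ c : C, h ∣ ∑ b, (S₀ b).count c)
    (hempty : ((h - 1) * n + (h - 1)) / h ≤
      (Finset.univ.filter (fun b : B => S₀ b = [])).card) :
    ∃ T : B → List C, SortedConfig h T ∧ Relation.ReflTransGen (WaterMove h) S₀ T := by
  have hdisj : Disjoint (Finset.univ.filter (fun b : B => (S₀ b).length = h))
      (Finset.univ.filter (fun b : B => S₀ b = [])) := by
    refine Finset.disjoint_filter.2 fun b _ hb hb' => ?_
    rw [hb', List.length_nil] at hb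
    omega
  have hcard := Finset.card_le_univ
    (Finset.univ.filter (fun b : B => (S₀ b).length = h) ∪
      Finset.univ.filter (fun b : B => S₀ b = []))
  rw [Finset.card_union_of_disjoint hdisj, hfull] at hcard
  refine Admissible.exists_sorted hh hcard ?_ ⟨fun b => ?_, hdiv, ?_, fun b b' hb _ hlt _ => ?_⟩
  · refine le_trans ?_ (Nat.mul_le_mul_left h hempty)
    have h1 := Nat.div_add_mod ((h - 1) * n + (h - 1)) h
    have h2 := Nat.mod_lt ((h - 1) * n + (h - 1)) hh
    omega
  · rcases hInit b with hb | hb <;> omega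
  · rw [← hfull, mul_comm, ← smul_eq_mul, ← Finset.sum_const, Finset.sum_filter]
    refine Finset.sum_congr rfl fun b _ => ?_
    rcases hInit b with hb | hb <;> split_ifs <;> omega
  · have := two_le_length_of_not_monochromatic hb
    rcases hInit b with hb | hb <;> omega
end
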